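/- Let Γ be a non-elementary hyperbolic group and let d, d* ∈ D_Γ. Then the mean distortion limit τ(d*/d) := lim_{T→∞} (#{g ∈ Γ : d(o,g) < T})^{−1} Σ_{g : d(o,g) < T} d*(o,g)/T exists and is strictly positive; moreover τ(d*/d) = −θ'_{d*/d}(0) and τ(d*/d) ≥ v_d/v_{d*}. Further, the following are equivalent: (1) d and d* are roughly similar; (2) the Manhattan curve θ_{d*/d} is a straight line; (3) τ(d*/d) = v_d/v_{d*}; (4) there exists τ > 0 such that ℓ_d[g] = τ·ℓ_{d*}[g] for all g ∈ Γ. -/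

import Mathlib

open Filter Set

namespace PaperCLT

variable {Γ : Type*} [Group Γ]

/-- Word length with respect to a generating set `S` (letters from `S ∪ S⁻¹`). -/
noncomputable def wordLength (S : Set Γ) (g : Γ) : ℕ :=
  sInf {n : ℕ | ∃ l : List Γ, l.length = n ∧ (∀ x ∈ l, x ∈ S ∪ S⁻¹) ∧ l.prod = g}

/-- The word metric associated to a generating set `S`. -/
noncomputable def wordDist (S : Set Γ) (x y : Γ) : ℝ := (wordLength S (x⁻¹ * y) : ℝ)

/-- `S` is a finite generating set of `Γ`. -/
def GeneratingSet (S : Set Γ) : Prop := S.Finite ∧ Subgroup.closure S = ⊤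

/-- `d` is a metric on `Γ`, viewed as a two-variable function. -/
structure IsMetric (d : Γ → Γ → ℝ) : Prop where
  refl : ∀ x, d x x = 0
  pos : ∀ x y, x ≠ y → 0 < d x y
  symm : ∀ x y, d x y = d y x
  triangle : ∀ x y z, d x z ≤ d x y + d y z

/-- The Gromov product `(x,y)_w`. -/
noncomputable def gromov (d : Γ → Γ → ℝ) (w x y : Γ) : ℝ := (d w x + d w y - d x y) / 2

/-- Gromov hyperbolicity of a (pseudo)metric. -/
def IsGromovHyperbolic (d : Γ → Γ → ℝ) : Prop :=
  ∃ δ : ℝ, 0 ≤ δ ∧ ∀ x y z w : Γ, min (gromov d w x z) (gromov d w y z) - δ ≤ gromov d w x y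

/-- `d'` is quasi-isometric to `d`. -/
def QuasiIsometric (d d' : Γ → Γ → ℝ) : Prop :=
  ∃ L > (0:ℝ), ∃ C ≥ (0:ℝ), ∀ x y : Γ,
    L⁻¹ * d x y - C ≤ d' x y ∧ d' x y ≤ L * d x y + C

/-- `d ∈ 𝒟_Γ`: left-invariant, Gromov hyperbolic, quasi-isometric to a word metric. -/
structure MemD (d : Γ → Γ → ℝ) : Prop where
  isMetric : IsMetric d
  leftInvariant : ∀ g x y : Γ, d (g * x) (g * y) = d x y
  hyperbolic : IsGromovHyperbolic d
  quasiIsom : ∃ S : Set Γ, GeneratingSet S ∧ QuasiIsometric (wordDist S) d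

/-- `Γ` is a hyperbolic group. -/
def IsHyperbolicGroup (Γ : Type*) [Group Γ] : Prop :=
  ∃ S : Set Γ, GeneratingSet S ∧ IsGromovHyperbolic (wordDist S)

/-- `Γ` is non-elementary: no cyclic subgroup of finite index. -/
def NonElementary (Γ : Type*) [Group Γ] : Prop :=
  ¬ ∃ H : Subgroup Γ, H.FiniteIndex ∧ IsCyclic H

/-- `Γ` is virtually free: it has a free subgroup of finite index. -/
def VirtuallyFree (Γ : Type*) [Group Γ] : Prop :=
  ∃ H : Subgroup Γ, H.FiniteIndex ∧ Nonempty (IsFreeGroup H)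

/-- Strong hyperbolicity of a metric. -/
def StronglyHyperbolic (d : Γ → Γ → ℝ) : Prop :=
  ∃ c > (0:ℝ), ∃ R₀ > (0:ℝ), ∀ R ≥ R₀, ∀ x x' y y' : Γ,
    R ≤ d x y - d x x' + d x' y' - d y y' →
    |d x y - d x' y - d x y' + d x' y'| ≤ Real.exp (-c * R)

/-- Rough similarity of two metrics. -/
def RoughlySimilar (d d' : Γ → Γ → ℝ) : Prop :=
  ∃ Λ > (0:ℝ), ∃ C > (0:ℝ), ∀ g h : Γ, |d g h - Λ * d' g h| ≤ C

/-- The (stable) translation length `ℓ_d[g] = lim_n d(o,gⁿ)/n`. -/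
noncomputable def translationLength (d : Γ → Γ → ℝ) (g : Γ) : ℝ :=
  limUnder atTop fun n : ℕ => d 1 (g ^ n) / n

/-- `d` has non-arithmetic length spectrum. -/
def NonArithmetic (d : Γ → Γ → ℝ) : Prop :=
  ¬ ∃ a : ℝ, ∀ g : Γ, ∃ k : ℤ, translationLength d g = a * k

/-- The ball `{g : d(o,g) < T}`. -/
def ball (d : Γ → Γ → ℝ) (T : ℝ) : Set Γ := {g : Γ | d 1 g < T}

/-- The exponential growth rate `v_d`. -/
noncomputable def growthRate (d : Γ → Γ → ℝ) : ℝ :=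
  limsup (fun T : ℝ => Real.log ((ball d T).ncard) / T) atTop

/-- `τ` is the mean distortion `τ(d⁎/d)`. -/
def IsMeanDistortion (d dst : Γ → Γ → ℝ) (τ : ℝ) : Prop :=
  Tendsto (fun T : ℝ => (((ball d T).ncard : ℝ))⁻¹ * ∑ᶠ g ∈ ball d T, dst 1 g / T)
    atTop (nhds τ)

/-- `σ2` is the variance `σ²(d⁎/d)` (relative to the normalisation `τ`). -/
def IsVariance (d dst : Γ → Γ → ℝ) (τ σ2 : ℝ) : Prop :=
  Tendsto (fun T : ℝ => (((ball d T).ncard : ℝ))⁻¹ *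
      ∑ᶠ g ∈ ball d T, (dst 1 g - τ * T) ^ 2 / T)
    atTop (nhds σ2)

/-- The distribution function `N_σ`: a centred Gaussian of standard deviation `σ > 0`,
and the point mass at `0` when `σ = 0`. -/
noncomputable def gaussCDF (σ t : ℝ) : ℝ :=
  if σ = 0 then (if t < 0 then 0 else 1)
  else (Real.sqrt (2 * Real.pi) * σ)⁻¹ * ∫ u in Set.Iic t, Real.exp (-u ^ 2 / (2 * σ ^ 2))

end PaperCLT

namespace PaperCLT

variable {Γ : Type*} [Group Γ]

/-- The Manhattan curve `θ_{d⁎/d}(s)`: the abscissa of convergence in `t` of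
`Σ_g e^{−s d⁎(o,g) − t d(o,g)}`. -/
noncomputable def manhattan (d dst : Γ → Γ → ℝ) (s : ℝ) : ℝ :=
  sInf {t : ℝ | Summable fun g : Γ => Real.exp (-(s * dst 1 g) - t * d 1 g)}

/-- Left-invariant metric with the four-point condition (disjunction form). -/
structure Hyp (d : Γ → Γ → ℝ) (δ : ℝ) : Prop where
  met : IsMetric d
  li : ∀ g x y : Γ, d (g * x) (g * y) = d x y
  nonneg : 0 ≤ δ
  fp : ∀ a b c e, d a b + d c e ≤ d a c + d b e + 2 * δ ∨ d a b + d c e ≤ d a e + d b c + 2 * δ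

lemma MemD.hyp {d : Γ → Γ → ℝ} (h : MemD d) : ∃ δ, Hyp d δ := by
  obtain ⟨δ, h0, hδ⟩ := h.hyperbolic
  refine ⟨δ, h.isMetric, h.leftInvariant, h0, ?_⟩
  intro a b c e
  have := hδ a b e c
  unfold gromov at this
  have s := h.isMetric.symm
  rw [s c a, s c b] at this
  rcases min_cases ((d a c + d c e - d a e) / 2) ((d b c + d c e - d b e) / 2) with ⟨h1, _⟩ | ⟨h1, _⟩
  · rw [h1] at this; right; linarith
  · rw [h1] at this; left; linarith

lemma Hyp.dnonneg {d : Γ → Γ → ℝ} {δ : ℝ} (h : Hyp d δ) (x y : Γ) : 0 ≤ d x y := by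
  have h1 := h.met.triangle x y x
  rw [h.met.refl, h.met.symm y x] at h1
  linarith

/-- Chain lemma for generalized points. -/
lemma chain {d : Γ → Γ → ℝ} {δ : ℝ} (D : Γ → ℝ) (hd : ∀ x, d x x = 0) (hs : ∀ x y, d x y = d y x)
    (gp : ∀ a b c, D c + d a b ≤ D b + d a c + 2 * δ ∨ D c + d a b ≤ D a + d b c + 2 * δ)
    (x : ℕ → Γ) (H s : ℝ) (hs0 : 0 ≤ s) (hδ : 0 ≤ δ) (k : ℕ) : ∀ i j : ℕ, i ≤ j → j ≤ i + 2 ^ k →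
    (∀ l, i ≤ l → l ≤ j → H ≤ D (x l)) → (∀ l, i ≤ l → l < j → d (x l) (x (l + 1)) ≤ s) →
    2 * H - s - 2 * δ * k ≤ D (x i) + D (x j) - d (x i) (x j) := by
  induction k with
  | zero =>
    intro i j hij hj hH hst
    have : j = i ∨ j = i + 1 := by simp at hj; omega
    have e1 := hH i le_rfl hij
    have e2 := hH j hij le_rfl
    rcases this with rfl | rfl
    · rw [hd]; simp; linarith
    · have := hst i le_rfl (by omega)
      simp; linarith
  | succ k ih =>
    intro i j hij hj hH hst
    have h2 : 0 ≤ 2 * δ * k := by positivity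
    by_cases hc : j ≤ i + 2 ^ k
    · have := ih i j hij hc hH hst
      push_cast; linarith
    · push Not at hc
      have hp : (2:ℕ) ^ (k + 1) = 2 ^ k + 2 ^ k := by ring
      set m := i + 2 ^ k with hm
      have a1 := ih i m (by omega) le_rfl (fun l h1 h2 => hH l h1 (by omega))
        (fun l h1 h2 => hst l h1 (by omega))
      have a2 := ih m j (by omega) (by omega) (fun l h1 h2 => hH l (by omega) h2)
        (fun l h1 h2 => hst l (by omega) h2)
      push_cast
      rcases gp (x i) (x j) (x m) with h | h
      · linarith
      · rw [hs (x j) (x m)] at h; linarith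

/-- Quasi-geodesic sequences. -/
def QG (d : Γ → Γ → ℝ) (L C : ℝ) (x : ℕ → Γ) (n : ℕ) : Prop :=
  ∀ i j : ℕ, i ≤ j → j ≤ n → d (x i) (x j) ≤ L * (j - i : ℝ) + C ∧ (j - i : ℝ) ≤ L * d (x i) (x j) + C

lemma exp_beats (a b e : ℝ) (he : 0 < e) :
    ∃ K : ℝ, 0 ≤ K ∧ ∀ H ≥ K, a * H + b ≤ 2 ^ (⌊H / e⌋₊) := by
  have h1 : Tendsto (fun k : ℕ => ((k : ℝ) ^ 1) / (2:ℝ) ^ k) atTop (nhds 0) :=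
    tendsto_pow_const_div_const_pow_of_one_lt 1 (by norm_num)
  have h2 : Tendsto (fun k : ℕ => (1:ℝ) / (2:ℝ) ^ k) atTop (nhds 0) := by
    simpa using tendsto_pow_const_div_const_pow_of_one_lt (r := (2:ℝ)) 0 (by norm_num)
  have h3 : Tendsto (fun k : ℕ => |a| * e * (((k : ℝ) ^ 1) / (2:ℝ) ^ k)
      + (|a| * e + |b|) * ((1:ℝ) / (2:ℝ) ^ k)) atTop (nhds (|a| * e * 0 + (|a| * e + |b|) * 0)) :=
    (h1.const_mul _).add (h2.const_mul _)
  have h4 := h3.eventually (gt_mem_nhds (show |a| * e * 0 + (|a| * e + |b|) * 0 < (1:ℝ) by norm_num))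
  obtain ⟨k0, hk0⟩ := eventually_atTop.1 h4
  refine ⟨e * k0, by positivity, fun H hH => ?_⟩
  have hH0 : 0 ≤ H := le_trans (by positivity) hH
  set k := ⌊H / e⌋₊ with hk
  have hkk : k0 ≤ k := Nat.le_floor (by rw [le_div_iff₀ he]; linarith)
  have h5 := hk0 k hkk
  have h6 : H / e < k + 1 := Nat.lt_floor_add_one _
  rw [div_lt_iff₀ he] at h6
  have hp : (0:ℝ) < 2 ^ k := by positivity
  have h7 : |a| * e * (k:ℝ) + (|a| * e + |b|) < 2 ^ k := by
    have : (|a| * e * (((k : ℝ) ^ 1) / (2:ℝ) ^ k) + (|a| * e + |b|) * ((1:ℝ) / (2:ℝ) ^ k))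
        = (|a| * e * (k:ℝ) + (|a| * e + |b|)) / 2 ^ k := by field_simp
    rw [this, div_lt_one hp] at h5
    exact h5
  have h8 : a * H ≤ |a| * H := mul_le_mul_of_nonneg_right (le_abs_self a) hH0
  have h9 : |a| * H ≤ |a| * ((k + 1) * e) := mul_le_mul_of_nonneg_left h6.le (abs_nonneg a)
  have := le_abs_self b
  nlinarith

/-- virtual point on the geodesic -/
noncomputable def Dt (d : Γ → Γ → ℝ) (p q : Γ) (t : ℝ) (z : Γ) : ℝ :=
  max (d p z - t) (d q z - (d p q - t))

lemma Dt_gp {d : Γ → Γ → ℝ} {δ : ℝ} (h : Hyp d δ) (p q : Γ) (t : ℝ) (a b c : Γ) :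
    Dt d p q t c + d a b ≤ Dt d p q t b + d a c + 2 * δ ∨
      Dt d p q t c + d a b ≤ Dt d p q t a + d b c + 2 * δ := by
  have s := h.met.symm
  have l1 : ∀ z, d p z - t ≤ Dt d p q t z := fun z => le_max_left _ _
  have l2 : ∀ z, d q z - (d p q - t) ≤ Dt d p q t z := fun z => le_max_right _ _
  have l1a := l1 a
  have l1b := l1 b
  have l2a := l2 a
  have l2b := l2 b
  rcases max_choice (d p c - t) (d q c - (d p q - t)) with hc | hc
  · have hc' : Dt d p q t c = d p c - t := hc
    rcases h.fp a b p c with h1 | h1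
    · right; rw [s a p] at h1; linarith
    · left; rw [s b p] at h1; linarith
  · have hc' : Dt d p q t c = d q c - (d p q - t) := hc
    rcases h.fp a b q c with h1 | h1
    · right; rw [s a q] at h1; linarith
    · left; rw [s b q] at h1; linarith

lemma morseA (δ L C : ℝ) (hδ : 0 ≤ δ) (hL : 0 ≤ L) (hC : 0 ≤ C) : ∃ K : ℝ, 0 ≤ K ∧
    ∀ (d : Γ → Γ → ℝ), Hyp d δ → ∀ (x : ℕ → Γ) (n : ℕ), QG d L C x n →
    ∀ t, 0 ≤ t → t ≤ d (x 0) (x n) → ∃ i ≤ n, Dt d (x 0) (x n) t (x i) ≤ K := by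
  obtain ⟨K0, hK0, hK⟩ := exp_beats (L * 6) (L * (2 * δ) + C) (2 * (δ + 1)) (by positivity)
  set s := L + C with hs
  refine ⟨K0 + (2 * δ + 2 + s + 1), by positivity, ?_⟩
  intro d hd x n hq
  set K := K0 + (2 * δ + 2 + s + 1) with hKdef
  set ℓ := d (x 0) (x n) with hℓ
  have sym := hd.met.symm
  have step : ∀ H ≥ K, (∀ t, 0 ≤ t → t ≤ ℓ → ∃ i ≤ n, Dt d (x 0) (x n) t (x i) ≤ H) →
      (∀ t, 0 ≤ t → t ≤ ℓ → ∃ i ≤ n, Dt d (x 0) (x n) t (x i) ≤ H - 1) := by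
    intro H hHK hall t ht0 htl
    by_contra hcon
    push Not at hcon
    have hH0 : 0 ≤ H := le_trans (by positivity) hHK
    obtain ⟨im, him, a1, b1⟩ : ∃ i ≤ n, d (x 0) (x i) ≤ t ∧ d (x n) (x i) ≤ ℓ - t + 3 * H := by
      by_cases hc : 2 * H ≤ t
      · obtain ⟨i, hi, hD⟩ := hall (t - 2 * H) (by linarith) (by linarith)
        have := le_trans (le_max_left _ _) hD
        have := le_trans (le_max_right _ _) hD
        exact ⟨i, hi, by linarith, by linarith⟩
      · push Not at hc
        refine ⟨0, Nat.zero_le _, by rw [hd.met.refl]; exact ht0, ?_⟩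
        rw [sym (x n) (x 0)]; linarith
    obtain ⟨ip, hip, a2, b2⟩ : ∃ i ≤ n, d (x 0) (x i) ≤ t + 3 * H ∧ d (x n) (x i) ≤ ℓ - t := by
      by_cases hc : t + 2 * H ≤ ℓ
      · obtain ⟨i, hi, hD⟩ := hall (t + 2 * H) (by linarith) (by linarith)
        have := le_trans (le_max_left _ _) hD
        have := le_trans (le_max_right _ _) hD
        exact ⟨i, hi, by linarith, by linarith⟩
      · push Not at hc
        refine ⟨n, le_rfl, ?_, by rw [hd.met.refl]; linarith⟩
        linarith
    have t1 := hd.met.triangle (x 0) (x im) (x n)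
    have t2 := hd.met.triangle (x 0) (x ip) (x n)
    rw [sym (x im) (x n)] at t1
    rw [sym (x ip) (x n)] at t2
    have D1 : Dt d (x 0) (x n) t (x im) ≤ d (x n) (x im) - (ℓ - t) :=
      max_le (by linarith) le_rfl
    have D2 : Dt d (x 0) (x n) t (x ip) ≤ d (x 0) (x ip) - t :=
      max_le le_rfl (by linarith)
    have dd : d (x im) (x ip) ≤ 6 * H + 2 * δ := by
      have s1 := sym (x im) (x 0)
      have s2 := sym (x im) (x n)
      have s3 := sym (x ip) (x 0)
      have s4 := sym (x ip) (x n)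
      rcases hd.fp (x im) (x ip) (x 0) (x n) with h | h <;> linarith
    have up : Dt d (x 0) (x n) t (x im) + Dt d (x 0) (x n) t (x ip) - d (x im) (x ip) ≤ 2 * δ := by
      have s1 := sym (x im) (x 0)
      have s2 := sym (x im) (x n)
      have s3 := sym (x ip) (x 0)
      have s4 := sym (x ip) (x n)
      have s5 := sym (x n) (x 0)
      have := hd.dnonneg (x im) (x ip)
      rcases hd.fp (x n) (x im) (x 0) (x ip) with h | h <;> linarith
    set k := ⌊H / (2 * (δ + 1))⌋₊ with hk
    have hbig := hK H (by linarith [hHK, show 0 ≤ 2 * δ + 2 + s + 1 by positivity])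
    have hLd : L * d (x im) (x ip) ≤ L * (6 * H + 2 * δ) := mul_le_mul_of_nonneg_left dd hL
    have hkH : 2 * δ * k ≤ H := by
      have : (k:ℝ) ≤ H / (2 * (δ + 1)) := Nat.floor_le (by positivity)
      rw [le_div_iff₀ (by positivity)] at this
      have : 0 ≤ (k:ℝ) := Nat.cast_nonneg _
      nlinarith
    have hstep : ∀ l, l < n → d (x l) (x (l + 1)) ≤ s := by
      intro l hl
      have := (hq l (l + 1) (by omega) (by omega)).1
      push_cast at this
      rw [hs]; nlinarith
    have fin : 2 * (H - 1) - s - 2 * δ * k ≤ Dt d (x 0) (x n) t (x im) +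
        Dt d (x 0) (x n) t (x ip) - d (x im) (x ip) := by
      rcases le_total im ip with hle | hle
      · refine chain (Dt d (x 0) (x n) t) hd.met.refl sym (Dt_gp hd _ _ t) x (H - 1) s
          (by positivity) hδ k im ip hle ?_ (fun l h1 h2 => (hcon l (by omega)).le)
          (fun l h1 h2 => hstep l (by omega))
        have := (hq im ip hle hip).2
        have h3 : ((ip:ℝ)) ≤ im + 2 ^ k := by linarith
        exact_mod_cast h3
      · have := chain (Dt d (x 0) (x n) t) hd.met.refl sym (Dt_gp hd _ _ t) x (H - 1) s
          (by positivity) hδ k ip im hle ?_ (fun l h1 h2 => (hcon l (by omega)).le)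
          (fun l h1 h2 => hstep l (by omega))
        · rw [sym (x im) (x ip)]; linarith
        have := (hq ip im hle him).2
        rw [sym (x ip) (x im)] at this
        have h3 : ((im:ℝ)) ≤ ip + 2 ^ k := by linarith
        exact_mod_cast h3
    linarith
  have desc : ∀ m : ℕ, (∀ t, 0 ≤ t → t ≤ ℓ → ∃ i ≤ n, Dt d (x 0) (x n) t (x i) ≤ K + m) →
      (∀ t, 0 ≤ t → t ≤ ℓ → ∃ i ≤ n, Dt d (x 0) (x n) t (x i) ≤ K) := by
    intro m
    induction m with
    | zero => intro h; simpa using h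
    | succ m ih =>
      intro h
      refine ih ?_
      have := step (K + (m + 1 : ℕ)) (by have : (0:ℝ) ≤ ((m+1:ℕ):ℝ) := Nat.cast_nonneg _
                                         linarith) h
      intro t h0 h1
      obtain ⟨i, hi, hh⟩ := this t h0 h1
      exact ⟨i, hi, by push_cast at hh; linarith⟩
  obtain ⟨m, hm⟩ := exists_nat_ge ℓ
  refine desc m (fun t h0 h1 => ⟨0, Nat.zero_le _, ?_⟩)
  have hK0' : 0 ≤ K := by positivity
  refine max_le ?_ ?_
  · rw [hd.met.refl]; linarith [hd.dnonneg (x 0) (x n)]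
  · rw [sym (x n) (x 0)]; linarith

lemma morse (δ L C : ℝ) (hδ : 0 ≤ δ) (hL : 0 ≤ L) (hC : 0 ≤ C) : ∃ K : ℝ, 0 ≤ K ∧
    ∀ (d : Γ → Γ → ℝ), Hyp d δ → ∀ (x : ℕ → Γ) (n : ℕ), QG d L C x n →
    ∀ j ≤ n, d (x 0) (x j) + d (x j) (x n) ≤ d (x 0) (x n) + K := by
  obtain ⟨K, hK0, hK⟩ := morseA (Γ := Γ) δ L C hδ hL hC
  refine ⟨2 * (K + (L * (L * (2 * K + 1 + 2 * δ) + C) + C)), by positivity, ?_⟩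
  intro d hd x n hq j hj
  set ℓ := d (x 0) (x n) with hℓ
  have hℓ0 : 0 ≤ ℓ := hd.dnonneg _ _
  have sym := hd.met.symm
  have key : ∃ t t' : ℝ, 0 ≤ t ∧ t ≤ ℓ ∧ |t - t'| ≤ 1 ∧ (∃ i ≤ j, Dt d (x 0) (x n) t (x i) ≤ K) ∧
      (∃ i ≥ j, i ≤ n ∧ Dt d (x 0) (x n) t' (x i) ≤ K) := by
    by_contra hcon
    push Not at hcon
    have ind : ∀ m : ℕ, ∃ i ≤ j, Dt d (x 0) (x n) (min m ℓ) (x i) ≤ K := by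
      intro m
      induction m with
      | zero =>
        refine ⟨0, Nat.zero_le _, max_le ?_ ?_⟩
        · rw [hd.met.refl]; simp [min_eq_left hℓ0, hK0]
        · rw [sym (x n) (x 0)]; simp [min_eq_left hℓ0, hK0]
      | succ m ih =>
        have h1 := hcon (min m ℓ) (min (m + 1 : ℕ) ℓ) (le_min (Nat.cast_nonneg _) hℓ0)
          (min_le_right _ _) ?_ ih
        · obtain ⟨i, hi, hD⟩ := hK d hd x n hq (min (m + 1 : ℕ) ℓ)
            (le_min (Nat.cast_nonneg _) hℓ0) (min_le_right _ _)
          refine ⟨i, ?_, hD⟩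
          by_contra hij
          exact absurd hD (not_le.2 (h1 i (by omega) hi))
        · have := abs_min_sub_min_le_max (m:ℝ) ℓ ((m + 1 : ℕ):ℝ) ℓ
          refine this.trans ?_
          simp
    obtain ⟨m, hm⟩ := exists_nat_ge ℓ
    have h1 := ind m
    rw [min_eq_right hm] at h1
    have := hcon ℓ ℓ hℓ0 le_rfl (by simp) h1 n hj le_rfl
    refine absurd this (not_lt.2 (max_le ?_ ?_))
    · simp [← hℓ, hK0]
    · rw [hd.met.refl]; simp [← hℓ, hK0]
  obtain ⟨t, t', h0, h1, htt, ⟨i, hij, hi⟩, ⟨i', hij', hin, hi'⟩⟩ := key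
  have a1 := le_trans (le_max_left _ _) hi
  have a2 := le_trans (le_max_right _ _) hi
  have b1 := le_trans (le_max_left _ _) hi'
  have b2 := le_trans (le_max_right _ _) hi'
  rw [abs_le] at htt
  have dd : d (x i) (x i') ≤ 2 * K + 1 + 2 * δ := by
    have s1 := sym (x i) (x 0)
    have s2 := sym (x i) (x n)
    have s3 := sym (x i') (x 0)
    have s4 := sym (x i') (x n)
    rcases hd.fp (x i) (x i') (x 0) (x n) with h | h <;> linarith
  have c1 := (hq i i' (by omega) hin).2
  have c2 := (hq i j hij hj).1
  have c3 : L * d (x i) (x i') ≤ L * (2 * K + 1 + 2 * δ) := mul_le_mul_of_nonneg_left dd hL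
  have c4 : (j:ℝ) ≤ i' := by exact_mod_cast hij'
  have c5 : L * (j - i : ℝ) ≤ L * (L * (2 * K + 1 + 2 * δ) + C) :=
    mul_le_mul_of_nonneg_left (by linarith) hL
  have e1 := hd.met.triangle (x 0) (x i) (x j)
  have e2 := hd.met.triangle (x n) (x i) (x j)
  rw [sym (x j) (x n)]
  linarith

lemma wl_le (S : Set Γ) (l : List Γ) (h : ∀ x ∈ l, x ∈ S ∪ S⁻¹) : wordLength S l.prod ≤ l.length :=
  Nat.sInf_le ⟨l, rfl, h, rfl⟩

lemma wl_spec {S : Set Γ} (hS : GeneratingSet S) (g : Γ) :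
    ∃ l : List Γ, l.length = wordLength S g ∧ (∀ x ∈ l, x ∈ S ∪ S⁻¹) ∧ l.prod = g := by
  have : ({n : ℕ | ∃ l : List Γ, l.length = n ∧ (∀ x ∈ l, x ∈ S ∪ S⁻¹) ∧ l.prod = g}).Nonempty := by
    have hg : g ∈ Subgroup.closure S := by rw [hS.2]; trivial
    rw [← Subgroup.mem_toSubmonoid, Subgroup.closure_toSubmonoid] at hg
    obtain ⟨l, hl, hp⟩ := Submonoid.exists_list_of_mem_closure hg
    exact ⟨l.length, l, rfl, hl, hp⟩
  exact Nat.sInf_mem this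

lemma wl_mul {S : Set Γ} (hS : GeneratingSet S) (g h : Γ) :
    wordLength S (g * h) ≤ wordLength S g + wordLength S h := by
  obtain ⟨l, h1, h2, h3⟩ := wl_spec hS g
  obtain ⟨l', h1', h2', h3'⟩ := wl_spec hS h
  have := wl_le S (l ++ l') (by intro x hx; rcases List.mem_append.1 hx with h | h; exacts [h2 x h, h2' x h])
  simpa [h1, h1', h3, h3'] using this

lemma wl_one (S : Set Γ) : wordLength S (1 : Γ) = 0 := by
  have := wl_le S [] (by simp)
  simpa using this

lemma wl_path {S : Set Γ} (hS : GeneratingSet S) (g : Γ) : ∃ x : ℕ → Γ, x 0 = 1 ∧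
    x (wordLength S g) = g ∧ ∀ i j, i ≤ j → j ≤ wordLength S g →
      wordLength S ((x i)⁻¹ * x j) = j - i := by
  obtain ⟨l, h1, h2, h3⟩ := wl_spec hS g
  set n := wordLength S g with hn
  have seg : ∀ i j, i ≤ j → j ≤ n → wordLength S ((l.take i).prod⁻¹ * (l.take j).prod) ≤ j - i := by
    intro i j hij hj
    have e : (l.take j) = l.take i ++ (l.take j).drop i := by
      have := List.take_append_drop i (l.take j)
      rw [List.take_take, min_eq_left hij] at this
      exact this.symm
    have e2 : (l.take i).prod⁻¹ * (l.take j).prod = ((l.take j).drop i).prod := by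
      conv_lhs => rw [e]
      rw [List.prod_append]; group
    rw [e2]
    refine (wl_le S _ ?_).trans ?_
    · intro x hx
      exact h2 x (List.mem_of_mem_take (List.mem_of_mem_drop hx))
    · simp; omega
  refine ⟨fun i => (l.take i).prod, by simp, by rw [← h1]; simpa using h3, ?_⟩
  intro i j hij hj
  have hlast : (l.take n).prod = g := by rw [← h1]; simpa using h3
  have a := seg i j hij hj
  have b := seg 0 i (Nat.zero_le _) (hij.trans hj)
  have c := seg j n hj le_rfl
  simp only [List.take_zero, List.prod_nil, inv_one, one_mul] at b
  rw [hlast] at c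
  have d1 := wl_mul hS (l.take i).prod ((l.take i).prod⁻¹ * (l.take j).prod)
  have d2 := wl_mul hS (l.take j).prod ((l.take j).prod⁻¹ * g)
  rw [mul_inv_cancel_left] at d1 d2
  show wordLength S ((l.take i).prod⁻¹ * (l.take j).prod) = j - i
  omega

lemma len_bound {S : Set Γ} (hS : GeneratingSet S) (f : Γ → ℝ) (h1 : f 1 ≤ 0)
    (hm : ∀ g h, f (g * h) ≤ f g + f h) : ∃ M : ℝ, 0 ≤ M ∧ ∀ g, f g ≤ M * wordLength S g := by
  have hfin : (S ∪ S⁻¹).Finite := hS.1.union hS.1.inv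
  obtain ⟨M, hM⟩ := (hfin.image f).bddAbove
  refine ⟨max M 0, le_max_right _ _, fun g => ?_⟩
  obtain ⟨l, e1, e2, e3⟩ := wl_spec hS g
  rw [← e1, ← e3]
  clear e1 e3
  induction l with
  | nil => simpa using h1
  | cons a l ih =>
    have ih' := ih (fun x hx => e2 x (List.mem_cons_of_mem _ hx))
    have ha : f a ≤ max M 0 := (hM ⟨a, e2 a (by simp), rfl⟩).trans (le_max_left _ _)
    have := hm a l.prod
    simp only [List.prod_cons, List.length_cons]
    push_cast
    linarith

lemma MemD.one_mul_le {d : Γ → Γ → ℝ} (h : MemD d) (g k : Γ) : d 1 (g * k) ≤ d 1 g + d 1 k := by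
  have h1 := h.isMetric.triangle 1 g (g * k)
  have h2 := h.leftInvariant g 1 k
  rw [mul_one] at h2
  linarith

lemma MemD.eq_one {d : Γ → Γ → ℝ} (h : MemD d) (x y : Γ) : d x y = d 1 (x⁻¹ * y) := by
  have h2 := h.leftInvariant x⁻¹ x y
  rw [inv_mul_cancel] at h2
  exact h2.symm

lemma MemD.inv {d : Γ → Γ → ℝ} (h : MemD d) (x : Γ) : d 1 x⁻¹ = d 1 x := by
  have h2 := h.eq_one x 1
  rw [mul_one] at h2
  rw [← h2, h.isMetric.symm]

lemma MemD.nn {d : Γ → Γ → ℝ} (h : MemD d) (x y : Γ) : 0 ≤ d x y := by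
  obtain ⟨δ, hδ⟩ := h.hyp
  exact hδ.dnonneg x y

lemma MemD.qi {d : Γ → Γ → ℝ} (h : MemD d) {S : Set Γ} (hS : GeneratingSet S) :
    ∃ L C : ℝ, 0 ≤ L ∧ 0 ≤ C ∧ ∀ g, d 1 g ≤ L * wordLength S g ∧ (wordLength S g : ℝ) ≤ L * d 1 g + C := by
  obtain ⟨M, hM0, hM⟩ := len_bound hS (fun g => d 1 g) (by simp [h.isMetric.refl]) h.one_mul_le
  obtain ⟨S', hS', L, hL, C, hC, hq⟩ := h.quasiIsom
  obtain ⟨N, hN0, hN⟩ := len_bound hS' (fun g => (wordLength S g : ℝ)) (by simp [wl_one])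
    (fun g k => by exact_mod_cast wl_mul hS g k)
  refine ⟨max M (N * L), N * L * C, le_max_of_le_left hM0, by positivity, fun g => ⟨?_, ?_⟩⟩
  · exact (hM g).trans (mul_le_mul_of_nonneg_right (le_max_left _ _) (Nat.cast_nonneg _))
  · have h1 := (hq 1 g).1
    simp only [wordDist, inv_one, one_mul] at h1
    have h2 := hN g
    have h3 : (wordLength S' g : ℝ) ≤ L * (d 1 g + C) := by
      have : L * (L⁻¹ * (wordLength S' g : ℝ)) ≤ L * (d 1 g + C) :=
        mul_le_mul_of_nonneg_left (by linarith) hL.le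
      rwa [mul_inv_cancel_left₀ hL.ne'] at this
    have h4 : N * (wordLength S' g : ℝ) ≤ N * (L * (d 1 g + C)) := mul_le_mul_of_nonneg_left h3 hN0
    have h5 : N * L * d 1 g ≤ max M (N * L) * d 1 g :=
      mul_le_mul_of_nonneg_right (le_max_right _ _) (h.nn _ _)
    nlinarith

/-- Finite balls. -/
lemma wl_finite {S : Set Γ} (hS : GeneratingSet S) (n : ℕ) : {g : Γ | wordLength S g ≤ n}.Finite := by
  have hfin : (S ∪ S⁻¹).Finite := hS.1.union hS.1.inv
  induction n with
  | zero =>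
    refine (Set.finite_singleton (1:Γ)).subset ?_
    intro g hg
    obtain ⟨l, h1, h2, h3⟩ := wl_spec hS g
    have hg' : wordLength S g ≤ 0 := hg
    have : l = [] := List.length_eq_zero_iff.1 (by omega)
    rw [← h3, this]; simp
  | succ n ih =>
    refine (((hfin.mul ih)).union (Set.finite_singleton (1:Γ))).subset ?_
    intro g hg
    obtain ⟨l, h1, h2, h3⟩ := wl_spec hS g
    have hg' : wordLength S g ≤ n + 1 := hg
    cases l with
    | nil => right; rw [← h3]; simp
    | cons a l =>
      left
      refine ⟨a, h2 a (by simp), l.prod, ?_, by simpa using h3⟩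
      have := wl_le S l (fun x hx => h2 x (List.mem_cons_of_mem _ hx))
      simp at h1
      show wordLength S l.prod ≤ n
      omega

lemma MemD.finite {d : Γ → Γ → ℝ} (h : MemD d) (T : ℝ) : {g : Γ | d 1 g ≤ T}.Finite := by
  obtain ⟨S, hS, -⟩ := h.quasiIsom
  obtain ⟨L, C, hL, hC, hq⟩ := h.qi hS
  obtain ⟨n, hn⟩ := exists_nat_ge (L * T + C)
  refine (wl_finite hS n).subset fun g hg => ?_
  have h1 := (hq g).2
  have h2 : L * d 1 g ≤ L * T := mul_le_mul_of_nonneg_left hg hL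
  have : (wordLength S g : ℝ) ≤ n := by linarith
  exact_mod_cast this

/-- points of word geodesics are nearly on `d`-geodesics. -/
lemma MemD.path {d : Γ → Γ → ℝ} (h : MemD d) {S : Set Γ} (hS : GeneratingSet S) :
    ∃ K : ℝ, 0 ≤ K ∧ ∀ (x : ℕ → Γ) (n : ℕ), (∀ i j, i ≤ j → j ≤ n →
      wordLength S ((x i)⁻¹ * x j) = j - i) → ∀ j ≤ n,
      d (x 0) (x j) + d (x j) (x n) ≤ d (x 0) (x n) + K := by
  obtain ⟨δ, hδ⟩ := h.hyp
  obtain ⟨L, C, hL, hC, hq⟩ := h.qi hS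
  obtain ⟨K, hK0, hK⟩ := morse (Γ := Γ) δ L C hδ.nonneg hL hC
  refine ⟨K, hK0, fun x n hx => hK d hδ x n ?_⟩
  intro i j hij hj
  have h1 := hq ((x i)⁻¹ * x j)
  rw [hx i j hij hj, Nat.cast_sub hij, ← h.eq_one] at h1
  exact ⟨by linarith [h1.1], h1.2⟩

/-- Gromov products of `d` and `d*` are comparable. -/
lemma star {d e : Γ → Γ → ℝ} (hd : MemD d) (he : MemD e) (r : ℝ) : ∃ r' : ℝ, 0 ≤ r' ∧
    ∀ g h : Γ, d 1 g + d 1 h ≤ d 1 (g * h) + r → e 1 g + e 1 h ≤ e 1 (g * h) + r' := by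
  obtain ⟨S, hS, -⟩ := hd.quasiIsom
  obtain ⟨δ, hδ⟩ := hd.hyp
  obtain ⟨δ', hδ'⟩ := he.hyp
  obtain ⟨L, C, hL, hC, hq⟩ := hd.qi hS
  obtain ⟨L', C', hL', hC', hq'⟩ := he.qi hS
  obtain ⟨K, hK0, hK⟩ := hd.path hS
  set K1 : ℝ := |r| + 4 * δ + 2 * K with hK1
  have hδ0 := hδ.nonneg
  have hK1p : 0 ≤ K1 := by positivity
  obtain ⟨r', hr0, hr⟩ := morse (Γ := Γ) δ' (L' + L * L * L') (C' + (L * L * C' + L * K1 + 2 * C))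
    hδ'.nonneg (by positivity) (by positivity)
  refine ⟨r', hr0, fun g h hgh => ?_⟩
  obtain ⟨x, hx0, hxn, hx⟩ := wl_path hS g
  obtain ⟨y, hy0, hyn, hy⟩ := wl_path hS h
  set n := wordLength S g with hn
  set m := wordLength S h with hm
  set z : ℕ → Γ := fun i => if i ≤ n then x i else g * y (i - n) with hz
  have z1 : ∀ i ≤ n, z i = x i := fun i hi => by simp [hz, hi]
  have z2 : ∀ i, n ≤ i → z i = g * y (i - n) := by
    intro i hi
    rcases hi.eq_or_lt with rfl | hi'
    · simp [hz, hxn, hy0]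
    · simp [hz, not_le.2 hi']
  have sym := hd.isMetric.symm
  have key : ∀ i j, i ≤ n → j ≤ m → d (x i) g + d 1 (y j) ≤ d (x i) (g * y j) + K1 := by
    intro i j hi hj
    have p1 := hK x n hx i hi
    have p2 := hK y m hy j hj
    rw [hx0, hxn] at p1
    rw [hy0, hyn] at p2
    have l1 := hd.leftInvariant g 1 (y j)
    have l2 := hd.leftInvariant g (y j) h
    have l3 := hd.leftInvariant g 1 h
    rw [mul_one] at l1 l3
    have ht1 := hd.isMetric.triangle (x i) (g * y j) g
    have ht2 := hd.isMetric.triangle g (x i) (g * y j)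
    have s1 := sym g (x i)
    have s2 := sym (g * y j) g
    have habs := le_abs_self r
    have n1 := hd.nn (x i) (g * y j)
    have n2 := hd.nn (x i) g
    have n3 := hd.nn g (g * y j)
    have n4 := hd.nn g (g * h)
    have t5 := hd.isMetric.triangle 1 (x i) (g * h)
    have t6 := hd.isMetric.triangle (x i) (g * y j) (g * h)
    have t7 := hd.isMetric.triangle 1 (x i) g
    have t8 := hd.isMetric.triangle g (g * y j) (g * h)
    have q1 : d (x i) g + d g (g * h) ≤ d (x i) (g * h) + |r| + K + 2 * δ := by
      linarith
    have q2 : d (x i) g + d g (g * y j) ≤ d (x i) (g * y j) + K1 := by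
      linarith
    rw [l1] at q2; exact q2
  have hzz : QG e (L' + L * L * L') (C' + (L * L * C' + L * K1 + 2 * C)) z (n + m) := by
    have seg : ∀ u v : Γ, ∀ k : ℝ, 0 ≤ k → (wordLength S (u⁻¹ * v) : ℝ) = k →
        e u v ≤ L' * k ∧ k ≤ L' * e u v + C' := by
      intro u v k hk huv
      have h1 := hq' (u⁻¹ * v)
      rw [huv, ← he.eq_one] at h1
      exact h1
    have weak : ∀ u v : Γ, ∀ k : ℝ, 0 ≤ k → e u v ≤ L' * k ∧ k ≤ L' * e u v + C' →
        e u v ≤ (L' + L * L * L') * k + (C' + (L * L * C' + L * K1 + 2 * C)) ∧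
        k ≤ (L' + L * L * L') * e u v + (C' + (L * L * C' + L * K1 + 2 * C)) := by
      intro u v k hk h1
      have hn := he.nn u v
      have a1 : 0 ≤ L * L * L' * k := by positivity
      have a2 : 0 ≤ L * L * L' * e u v := by positivity
      have a3 : 0 ≤ C' + (L * L * C' + L * K1 + 2 * C) := by positivity
      have a4 : 0 ≤ L * L * C' + L * K1 + 2 * C := by positivity
      constructor
      · nlinarith [h1.1]
      · nlinarith [h1.2]
    intro i j hij hj
    have hk : (0:ℝ) ≤ j - i := by have : (i:ℝ) ≤ j := by exact_mod_cast hij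
                                  linarith
    by_cases hjn : j ≤ n
    · rw [z1 i (hij.trans hjn), z1 j hjn]
      refine weak _ _ _ hk (seg _ _ _ hk ?_)
      rw [hx i j hij hjn, Nat.cast_sub hij]
    · push Not at hjn
      by_cases hin : n ≤ i
      · rw [z2 i hin, z2 j hjn.le]
        refine weak _ _ _ hk (seg _ _ _ hk ?_)
        have : (g * y (i - n))⁻¹ * (g * y (j - n)) = (y (i - n))⁻¹ * y (j - n) := by group
        rw [this, hy (i - n) (j - n) (by omega) (by omega)]
        rw [← Nat.cast_sub hij]; congr 1; omega
      · push Not at hin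
        rw [z1 i hin.le, z2 j hjn.le]
        have k1 := key i (j - n) hin.le (by omega)
        have A1 := hq ((x i)⁻¹ * g)
        have A2 := hq (y (j - n))
        have A1' := hq' ((x i)⁻¹ * g)
        have A2' := hq' (y (j - n))
        have w1 : (wordLength S ((x i)⁻¹ * g) : ℝ) = n - i := by
          have := hx i n hin.le le_rfl
          rw [hxn] at this
          rw [this, Nat.cast_sub hin.le]
        have w2 : (wordLength S (y (j - n)) : ℝ) = j - n := by
          have := hy 0 (j - n) (Nat.zero_le _) (by omega)
          rw [hy0] at this
          simp only [inv_one, one_mul, Nat.sub_zero] at this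
          rw [this, Nat.cast_sub hjn.le]
        rw [w1, ← hd.eq_one] at A1
        rw [w2] at A2
        rw [w1, ← he.eq_one] at A1'
        rw [w2] at A2'
        have B := hq ((x i)⁻¹ * (g * y (j - n)))
        have B' := hq' ((x i)⁻¹ * (g * y (j - n)))
        rw [← hd.eq_one] at B
        rw [← he.eq_one] at B'
        have ht := he.isMetric.triangle (x i) g (g * y (j - n))
        have l1 := he.leftInvariant g 1 (y (j - n))
        rw [mul_one] at l1
        set E := e (x i) (g * y (j - n))
        have hE : 0 ≤ E := he.nn _ _
        have m1 : L * (d (x i) g + d 1 (y (j - n))) ≤ L * (d (x i) (g * y (j - n)) + K1) :=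
          mul_le_mul_of_nonneg_left k1 hL
        have m2 : L * d (x i) (g * y (j - n)) ≤ L * (L * (L' * E + C')) :=
          mul_le_mul_of_nonneg_left (B.1.trans (mul_le_mul_of_nonneg_left B'.2 hL)) hL
        constructor
        · have a1 : 0 ≤ L * L * L' * (j - i : ℝ) := by positivity
          have a3 : 0 ≤ C' + (L * L * C' + L * K1 + 2 * C) := by positivity
          nlinarith [A1'.1, A2'.1]
        · have a1 : 0 ≤ L' * E := by positivity
          nlinarith [A1.2, A2.2]
  have fin := hr e hδ' z (n + m) hzz n (by omega)
  rw [z1 0 (Nat.zero_le _), z1 n le_rfl, z2 (n + m) (by omega), hx0, hxn, Nat.add_sub_cancel_left, hyn] at fin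
  have l1 := he.leftInvariant g 1 h
  rw [mul_one] at l1
  linarith

/-- rough geodesics, simultaneously for both metrics -/
lemma split {d e : Γ → Γ → ℝ} (hd : MemD d) (he : MemD e) : ∃ C : ℝ, 0 ≤ C ∧
    ∀ g : Γ, ∀ t, 0 ≤ t → t ≤ d 1 g → ∃ p, |d 1 p - t| ≤ C ∧ d 1 p + d 1 (p⁻¹ * g) ≤ d 1 g + C ∧
      e 1 p + e 1 (p⁻¹ * g) ≤ e 1 g + C := by
  obtain ⟨S, hS, -⟩ := hd.quasiIsom
  obtain ⟨L, C, hL, hC, hq⟩ := hd.qi hS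
  obtain ⟨K, hK0, hK⟩ := hd.path hS
  obtain ⟨K', hK0', hK'⟩ := he.path hS
  refine ⟨L + K + K', by positivity, fun g t ht0 ht => ?_⟩
  obtain ⟨x, hx0, hxn, hx⟩ := wl_path hS g
  set n := wordLength S g with hn
  have : ∃ i ≤ n, |d 1 (x i) - t| ≤ L := by
    by_contra hcon
    push Not at hcon
    have ind : ∀ i, i ≤ n → d 1 (x i) < t := by
      intro i
      induction i with
      | zero =>
        intro _
        have := hcon 0 (Nat.zero_le _)
        rw [hx0, hd.isMetric.refl] at this ⊢
        rcases ht0.eq_or_lt with h | h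
        · rw [← h] at this; simp at this; linarith
        · exact h
      | succ i ih =>
        intro hi
        have h1 := ih (by omega)
        have h2 := hcon (i + 1) hi
        have h3 := hd.one_mul_le (x i) ((x i)⁻¹ * x (i + 1))
        rw [mul_inv_cancel_left] at h3
        have h4 := (hq ((x i)⁻¹ * x (i + 1))).1
        rw [hx i (i+1) (by omega) hi] at h4
        simp at h4
        by_contra h5
        push Not at h5
        rw [abs_of_nonneg (by linarith)] at h2
        linarith
    have := ind n le_rfl
    rw [hxn] at this
    linarith
  obtain ⟨i, hi, hti⟩ := this
  have p1 := hK x n hx i hi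
  have p2 := hK' x n hx i hi
  rw [hx0, hxn] at p1 p2
  rw [hd.eq_one (x i) g] at p1
  rw [he.eq_one (x i) g] at p2
  exact ⟨x i, by linarith, by linarith, by linarith⟩

/-- two points near a geodesic, in order -/
lemma order1 {d : Γ → Γ → ℝ} {δ : ℝ} (hd : Hyp d δ) (r : ℝ) (k u x : Γ)
    (h1 : d 1 u + d u k ≤ d 1 k + r) (h2 : d 1 x + d x k ≤ d 1 k + r) (h3 : d 1 u ≤ d 1 x + r) :
    d 1 u + d u x ≤ d 1 x + (3 * |r| + 2 * δ) := by
  have s := hd.met.symm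
  have := le_abs_self r
  have t1 := hd.met.triangle 1 x k
  have t2 := hd.met.triangle 1 u k
  have s1 := s u 1
  have s2 := s x 1
  have := hd.nonneg
  rcases hd.fp u x 1 k with h | h <;> linarith

/-- twice the Gromov product based at the identity -/
def g2 (d : Γ → Γ → ℝ) (x y : Γ) : ℝ := d 1 x + d 1 y - d x y

lemma g2_hyp {d : Γ → Γ → ℝ} {δ : ℝ} (h : Hyp d δ) (x y z : Γ) (c : ℝ) (h1 : c ≤ g2 d x y)
    (h2 : c ≤ g2 d y z) : c - 2 * δ ≤ g2 d x z := by
  unfold g2 at *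
  have s := h.met.symm
  have s1 := s x 1
  have s2 := s z 1
  have s3 := s z y
  rcases h.fp x z 1 y with q | q <;> linarith

lemma g2_symm {d : Γ → Γ → ℝ} {δ : ℝ} (h : Hyp d δ) (x y : Γ) : g2 d x y = g2 d y x := by
  unfold g2
  rw [h.met.symm x y]; ring

lemma g2_trans {d : Γ → Γ → ℝ} (h : MemD d) (f x y : Γ) :
    g2 d x y - 2 * d 1 f ≤ g2 d (f * x) (f * y) := by
  unfold g2
  rw [h.leftInvariant]
  have h1 := h.one_mul_le f⁻¹ (f * x)
  have h2 := h.one_mul_le f⁻¹ (f * y)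
  rw [inv_mul_cancel_left, h.inv] at h1 h2
  linarith

lemma g2_le {d : Γ → Γ → ℝ} (h : MemD d) (x y : Γ) : g2 d x y ≤ 2 * d 1 x := by
  unfold g2
  have := h.isMetric.triangle 1 x y
  linarith

/-- A quasimorphism with finite sublevel sets on a finite index subgroup. -/
lemma elementary_of_qm (H : Subgroup Γ) [H.FiniteIndex] (β : Γ → ℝ) (δ : ℝ) (hδ : 0 ≤ δ)
    (hβ1 : β 1 = 0)
    (hβ : ∀ f ∈ H, ∀ g ∈ H, |β (f * g) - β f - β g| ≤ 2 * δ)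
    (hfin : ∀ L : ℝ, {f | f ∈ H ∧ |β f| ≤ L}.Finite) : ¬ NonElementary Γ := by
  intro hNE
  apply hNE
  have hR : (Set.range (fun q : Γ ⧸ H => q.out)).Finite := Set.finite_range _
  have key : ∀ (g : Γ) (E0 : Set Γ), E0.Finite → (∀ f ∈ H, ∃ z ∈ Subgroup.zpowers g, f * z ∈ E0) →
      (Subgroup.zpowers g).FiniteIndex := by
    intro g E0 hE0 hz
    have : Finite (Γ ⧸ Subgroup.zpowers g) := by
      rw [← Set.finite_univ_iff]
      refine ((hR.mul hE0).image (fun x : Γ => (x : Γ ⧸ Subgroup.zpowers g))).subset ?_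
      intro q _
      induction q using QuotientGroup.induction_on with
      | H x =>
        have hx : (((x : Γ ⧸ H).out)⁻¹ * x) ∈ H := by
          rw [← QuotientGroup.eq]; simp
        obtain ⟨z, hz1, hz2⟩ := hz _ hx
        refine ⟨(x : Γ ⧸ H).out * (((x : Γ ⧸ H).out)⁻¹ * x * z), Set.mul_mem_mul ⟨_, rfl⟩ hz2, ?_⟩
        have e : (x : Γ ⧸ H).out * (((x : Γ ⧸ H).out)⁻¹ * x * z) = x * z := by group
        show ((_ : Γ) : Γ ⧸ Subgroup.zpowers g) = x
        rw [e, QuotientGroup.eq]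
        have : (x * z)⁻¹ * x = z⁻¹ := by group
        rw [this]
        exact inv_mem hz1
    exact Subgroup.finiteIndex_of_finite_quotient
  by_cases hall : ∀ g ∈ H, |β g| ≤ 4 * δ + 1
  · refine ⟨Subgroup.zpowers 1, key 1 _ (hfin (4 * δ + 1)) ?_, inferInstance⟩
    intro f hf
    exact ⟨1, one_mem _, by simpa using ⟨hf, hall f hf⟩⟩
  · push Not at hall
    obtain ⟨g, hgH, hg⟩ := hall
    set b := |β g| with hb
    refine ⟨Subgroup.zpowers g, key g _ (hfin b) ?_, inferInstance⟩
    have hinv : |β g⁻¹ + β g| ≤ 2 * δ := by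
      have := hβ g⁻¹ (inv_mem hgH) g hgH
      rw [inv_mul_cancel, hβ1] at this
      rw [← abs_neg]; convert this using 2; ring
    have ind : ∀ n : ℕ, ∀ f ∈ H, |β f| ≤ b + n →
        ∃ z ∈ Subgroup.zpowers g, f * z ∈ {f | f ∈ H ∧ |β f| ≤ b} := by
      intro n
      induction n with
      | zero => intro f hf hfb; exact ⟨1, one_mem _, by simpa using ⟨hf, by simpa using hfb⟩⟩
      | succ n ih =>
        intro f hf hfb
        by_cases hsm : |β f| ≤ b
        · exact ⟨1, one_mem _, by simpa using ⟨hf, hsm⟩⟩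
        push Not at hsm
        have hz : ∃ z ∈ Subgroup.zpowers g, z ∈ H ∧ |β (f * z)| ≤ b + n := by
          have q1 := abs_le.1 (hβ f hf g hgH)
          have q2 := abs_le.1 (hβ f hf g⁻¹ (inv_mem hgH))
          have q3 := abs_le.1 hinv
          have hn : (0:ℝ) ≤ n := Nat.cast_nonneg _
          push_cast at hfb
          have hmem := Subgroup.mem_zpowers g
          rcases abs_cases (β g) with ⟨e1, e2⟩ | ⟨e1, e2⟩ <;>
          rcases abs_cases (β f) with ⟨e3, e4⟩ | ⟨e3, e4⟩
          · exact ⟨g⁻¹, inv_mem hmem, inv_mem hgH, abs_le.2 ⟨by linarith, by linarith⟩⟩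
          · exact ⟨g, hmem, hgH, abs_le.2 ⟨by linarith, by linarith⟩⟩
          · exact ⟨g, hmem, hgH, abs_le.2 ⟨by linarith, by linarith⟩⟩
          · exact ⟨g⁻¹, inv_mem hmem, inv_mem hgH, abs_le.2 ⟨by linarith, by linarith⟩⟩
        obtain ⟨z, hz1, hz2, hz3⟩ := hz
        obtain ⟨z', h1, h2⟩ := ih (f * z) (mul_mem hf hz2) hz3
        exact ⟨z * z', mul_mem hz1 h1, by rw [← mul_assoc]; exact h2⟩
    intro f hf
    obtain ⟨n, hn⟩ := exists_nat_ge (|β f|)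
    exact ind n f hf (by have := abs_nonneg (β g); linarith)

lemma diverge {d : Γ → Γ → ℝ} (hd : MemD d) (hNE : NonElementary Γ) (k : ℕ) :
    ∃ C : ℝ, ∀ y : Γ, ∃ f : Fin k → Γ, (∀ i, d 1 (f i) ≤ C) ∧
      ∀ i j, i ≠ j → g2 d (f i * y) (f j * y) ≤ C := by
  by_contra hcon
  push Not at hcon
  obtain ⟨δ, hδ⟩ := hd.hyp
  obtain ⟨C, hC0, hC⟩ := split hd hd
  have hyn : ∀ n : ℕ, ∃ y : Γ, ∀ f : Fin k → Γ, (∀ i, d 1 (f i) ≤ n) →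
      ∃ i j, i ≠ j ∧ (n:ℝ) < g2 d (f i * y) (f j * y) := fun n => hcon n
  choose y hy using hyn
  let U : Filter ℕ := (hyperfilter ℕ : Ultrafilter ℕ)
  have hUtop : U ≤ atTop := by
    have := hyperfilter_le_cofinite (α := ℕ)
    rwa [Nat.cofinite_eq_atTop] at this
  have : U.NeBot := by infer_instance
  have hnat : Tendsto (fun n : ℕ => (n:ℝ)) U atTop := tendsto_natCast_atTop_atTop.mono_left hUtop
  have hyinf : ∀ n : ℕ, (n:ℝ) ≤ 2 * d 1 (y n) := by
    intro n
    obtain ⟨i, j, -, h⟩ := hy n (fun _ => 1) (fun _ => by rw [hd.isMetric.refl]; positivity)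
    have := g2_le hd (1 * y n) (1 * y n)
    rw [one_mul] at *
    linarith
  have hyt : Tendsto (fun n => d 1 (y n)) U atTop := by
    have : Tendsto (fun n => 2 * d 1 (y n)) U atTop := tendsto_atTop_mono hyinf hnat
    exact (tendsto_const_mul_atTop_of_pos (by norm_num : (0:ℝ) < 2)).1 this
  let P : Γ → Prop := fun f => Tendsto (fun n => g2 d (f * y n) (y n)) U atTop
  have P1 : P 1 := by
    have : (fun n => g2 d (1 * y n) (y n)) = fun n => 2 * d 1 (y n) := by
      funext n; unfold g2; rw [one_mul, hd.isMetric.refl]; ring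
    show Tendsto _ _ _
    rw [this]
    exact hyt.const_mul_atTop (by norm_num)
  have Pmul : ∀ f g, P f → P g → P (f * g) := by
    intro f g hf hg
    refine tendsto_atTop.2 fun c => ?_
    filter_upwards [tendsto_atTop.1 hf (c + 2 * δ), tendsto_atTop.1 hg (c + 2 * δ + 2 * d 1 f)] with n h1 h2
    have h3 := g2_trans hd f (g * y n) (y n)
    have := g2_hyp hδ (f * (g * y n)) (f * y n) (y n) (c + 2 * δ) (by linarith) h1
    rw [mul_assoc]; linarith
  have Pinv : ∀ f, P f → P f⁻¹ := by
    intro f hf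
    refine tendsto_atTop.2 fun c => ?_
    filter_upwards [tendsto_atTop.1 hf (c + 2 * d 1 f)] with n h1
    have h3 := g2_trans hd f⁻¹ (f * y n) (y n)
    rw [inv_mul_cancel_left, hd.inv, g2_symm hδ (y n) (f⁻¹ * y n)] at h3
    linarith
  let H : Subgroup Γ := { carrier := {f | P f}, mul_mem' := fun {a b} ha hb => Pmul a b ha hb, one_mem' := P1,
                          inv_mem' := fun {a} ha => Pinv a ha }
  have hHfin : H.FiniteIndex := by
    have : Finite (Γ ⧸ H) := by
      by_contra hinf
      rw [not_finite_iff_infinite] at hinf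
      obtain ⟨q⟩ : Nonempty (Fin k ↪ Γ ⧸ H) := ⟨(Fin.valEmbedding).trans (Infinite.natEmbedding _)⟩
      let f : Fin k → Γ := fun i => (q i).out
      obtain ⟨R, hR⟩ : ∃ R : ℝ, ∀ i, d 1 (f i) ≤ R :=
        ⟨∑ i, d 1 (f i), fun i => Finset.single_le_sum (f := fun i => d 1 (f i)) (fun i _ => hd.nn _ _) (Finset.mem_univ i)⟩
      have hev : ∀ᶠ n : ℕ in U, ∃ p ∈ (Finset.univ : Finset (Fin k × Fin k)), p.1 ≠ p.2 ∧ (n:ℝ) < g2 d (f p.1 * y n) (f p.2 * y n) := by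
        filter_upwards [tendsto_atTop.1 hnat R] with n hn
        obtain ⟨i, j, h1, h2⟩ := hy n f (fun i => (hR i).trans hn)
        exact ⟨(i, j), Finset.mem_univ _, h1, h2⟩
      have hev2 : ∃ p ∈ (Finset.univ : Finset (Fin k × Fin k)), ∀ᶠ n : ℕ in U, p.1 ≠ p.2 ∧ (n:ℝ) < g2 d (f p.1 * y n) (f p.2 * y n) := by
        have := (Ultrafilter.finite_biUnion_mem_iff (f := hyperfilter ℕ) (is := ((Finset.univ : Finset (Fin k × Fin k)) : Set (Fin k × Fin k)))
          (s := fun p => {n : ℕ | p.1 ≠ p.2 ∧ (n:ℝ) < g2 d (f p.1 * y n) (f p.2 * y n)}) (Finset.finite_toSet _)).1 (by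
            refine Filter.mem_of_superset hev ?_
            intro n hn
            obtain ⟨p, hp, hp2⟩ := hn
            exact Set.mem_biUnion (Finset.mem_coe.2 hp) hp2)
        obtain ⟨p, hp, h⟩ := this
        exact ⟨p, Finset.mem_coe.1 hp, h⟩
      obtain ⟨⟨i, j⟩, -, hp⟩ := hev2
      have hij : i ≠ j := by
        obtain ⟨n, hn⟩ := hp.exists
        exact hn.1
      apply hij
      apply q.injective
      have : (((q j).out : Γ) : Γ ⧸ H) = (((q i).out : Γ) : Γ ⧸ H) := by
        rw [QuotientGroup.eq]
        show P _
        refine tendsto_atTop.2 fun c => ?_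
        filter_upwards [hp, tendsto_atTop.1 hnat (c + 2 * d 1 (f j))] with n h1 h2
        have h3 := g2_trans hd (f j)⁻¹ (f i * y n) (f j * y n)
        rw [inv_mul_cancel_left, hd.inv] at h3
        have h4 : (f j)⁻¹ * (f i * y n) = (q j).out⁻¹ * (q i).out * y n := by simp only [f]; group
        rw [h4] at h3
        linarith [h1.2]
      simpa using this.symm
    exact Subgroup.finiteIndex_of_finite_quotient
  have hlim : ∀ f : Γ, ∃ b : ℝ, Tendsto (fun n => d 1 (f * y n) - d 1 (y n)) U (nhds b) := by
    intro f
    have hbd : ∀ n, d 1 (f * y n) - d 1 (y n) ∈ Set.Icc (-(d 1 f)) (d 1 f) := by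
      intro n
      have h1 := hd.one_mul_le f⁻¹ (f * y n)
      have h2 := hd.one_mul_le f (y n)
      rw [inv_mul_cancel_left, hd.inv] at h1
      constructor <;> linarith
    have := (isCompact_Icc (a := -(d 1 f)) (b := d 1 f)).ultrafilter_le_nhds
      ((hyperfilter ℕ).map (fun n => d 1 (f * y n) - d 1 (y n))) (by
        rw [le_principal_iff]
        exact Filter.mem_map.2 (Filter.univ_mem' hbd))
    obtain ⟨b, -, hb⟩ := this
    exact ⟨b, hb⟩
  choose β hβ using hlim
  refine elementary_of_qm H β δ hδ.nonneg ?_ ?_ ?_ hNE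
  · refine tendsto_nhds_unique (hβ 1) ?_
    simp
  · intro f hf g hg
    have ht := ((hβ (f * g)).sub (hβ f)).sub (hβ g)
    have hc : ∀ᶠ n in U, d 1 (f * g * y n) - d 1 (y n) - (d 1 (f * y n) - d 1 (y n))
        - (d 1 (g * y n) - d 1 (y n)) ∈ Set.Icc (-(2 * δ)) (2 * δ) := by
      filter_upwards [tendsto_atTop.1 hg (2 * d 1 f + 2 * δ + 1)] with n hn
      unfold g2 at hn
      have e1 : d 1 (f * g * y n) = d f⁻¹ (g * y n) := by
        rw [← hd.leftInvariant f f⁻¹ (g * y n), mul_inv_cancel, mul_assoc]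
      have e2 : d 1 (f * y n) = d f⁻¹ (y n) := by
        rw [← hd.leftInvariant f f⁻¹ (y n), mul_inv_cancel]
      have s := hd.isMetric.symm
      have i := hd.inv f
      have s1 := s f⁻¹ 1
      have s2 := s (g * y n) (y n)
      have s3 := s (y n) 1
      have s4 := s (g * y n) 1
      have t1 := hd.isMetric.triangle 1 f⁻¹ (g * y n)
      have t2 := hd.isMetric.triangle 1 f⁻¹ (y n)
      have hn0 := hδ.nonneg
      rw [e1, e2]
      constructor
      · rcases hδ.fp f⁻¹ (y n) 1 (g * y n) with q | q <;> linarith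
      · rcases hδ.fp f⁻¹ (g * y n) 1 (y n) with q | q <;> linarith
    have := isClosed_Icc.mem_of_tendsto ht hc
    exact abs_le.2 this
  · intro L
    set M : ℝ := 3 * (L + 1) + 6 * δ + 2 * C with hM
    have hball := hd.finite M
    by_contra hinf
    obtain ⟨E, hE, hcard⟩ := Set.Infinite.exists_subset_card_eq hinf (hball.toFinset.card + 1)
    obtain ⟨R, hR⟩ : ∃ R : ℝ, ∀ f ∈ E, d 1 f ≤ R :=
      ⟨∑ f ∈ E, d 1 f, fun f hf => Finset.single_le_sum (f := fun f => d 1 f) (fun i _ => hd.nn _ _) hf⟩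
    set T : ℝ := |R| + |L| + 3 * C + 2 * δ + 1 with hT
    have hn0 := hδ.nonneg
    have hT0 : 0 ≤ T := by positivity
    have e1 : ∀ᶠ n in U, ∀ f ∈ E, |d 1 (f * y n) - d 1 (y n)| ≤ L + 1 := by
      rw [Finset.eventually_all]
      intro f hf
      have hb := abs_le.1 (hE hf).2
      filter_upwards [(hβ f).eventually (Icc_mem_nhds (a := -(L+1)) (b := L + 1) (by linarith) (by linarith))] with n hn
      exact abs_le.2 hn
    have e2 : ∀ᶠ n in U, ∀ f ∈ E, 2 * (T + C) ≤ g2 d (f * y n) (y n) := by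
      rw [Finset.eventually_all]
      intro f hf
      exact tendsto_atTop.1 (hE hf).1 _
    obtain ⟨n, h1, h2, h3⟩ := (e1.and (e2.and (tendsto_atTop.1 hyt T))).exists
    obtain ⟨p, hp1, hp2, -⟩ := hC (y n) T hT0 h3
    rw [← hd.eq_one] at hp2
    have hp1 := abs_le.1 hp1
    have hle : E.card ≤ hball.toFinset.card := by
      refine Finset.card_le_card_of_injOn (fun f => p⁻¹ * f * p) ?_ ?_
      · intro f hf
        simp only [Finset.mem_coe, Set.Finite.mem_toFinset, Set.mem_ofPred_eq]
        rw [mul_assoc, ← hd.eq_one]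
        have a1 := abs_le.1 (h1 f hf)
        have a2 := h2 f hf
        have a3 := hR f hf
        have l1 := hd.leftInvariant f p (y n)
        have l2 := hd.leftInvariant f 1 (y n)
        have l3 := hd.leftInvariant f 1 p
        rw [mul_one] at l2 l3
        have s := hd.isMetric.symm
        have t0 := hd.isMetric.triangle 1 p (y n)
        have t1 := hd.isMetric.triangle 1 (f * p) (f * y n)
        have t2 := hd.isMetric.triangle f 1 (f * p)
        have s1 := s f 1
        have s2 := s (f * p) f
        have s3 := s (f * y n) (y n)
        have s4 := s (f * y n) (f * p)
        have s5 := s (f * p) p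
        have s6 := s (f * y n) 1
        have r1 := le_abs_self R
        have r2 := le_abs_self L
        have r3 := neg_abs_le L
        have up : d 1 (f * p) ≤ d 1 p + L + 1 + 2 * δ := by
          rcases hδ.fp 1 (f * p) f (f * y n) with q | q <;> linarith
        have b1 : 2 * d 1 p - 2 * (L + 1) - 2 * C ≤ g2 d p (y n) := by unfold g2; linarith
        have b3 : 2 * d 1 p - 2 * (L + 1) - 2 * C ≤ g2 d (f * y n) (f * p) := by unfold g2; linarith
        have b2 : 2 * d 1 p - 2 * (L + 1) - 2 * C ≤ g2 d (y n) (f * y n) := by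
          rw [g2_symm hδ]; linarith
        have b4 := g2_hyp hδ _ _ _ _ b1 b2
        have b5 := g2_hyp hδ _ _ _ _ b4 (by linarith)
        unfold g2 at b5
        linarith
      · intro a _ b _ hab
        simpa using hab
    omega

lemma NonElementary.infinite (h : NonElementary Γ) : Infinite Γ := by
  by_contra hfin
  rw [not_infinite_iff_finite] at hfin
  exact h ⟨⊥, inferInstance, inferInstance⟩

lemma MemD.far {d : Γ → Γ → ℝ} (hd : MemD d) (h : NonElementary Γ) (T : ℝ) : ∃ g, T < d 1 g := by
  have := h.infinite
  by_contra hcon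
  push Not at hcon
  have h2 := hd.finite T
  have : {g : Γ | d 1 g ≤ T} = Set.univ := Set.eq_univ_of_forall hcon
  rw [this] at h2
  exact Set.infinite_univ h2

lemma finset_bound (F : Finset Γ) (φ : Γ → ℝ) (hφ : ∀ g, 0 ≤ φ g) : ∃ R : ℝ, 0 ≤ R ∧ ∀ f ∈ F, φ f ≤ R :=
  ⟨∑ f ∈ F, φ f, Finset.sum_nonneg fun i _ => hφ i, fun _ hf =>
    Finset.single_le_sum (f := φ) (fun i _ => hφ i) hf⟩

lemma join {d e : Γ → Γ → ℝ} (hd : MemD d) (he : MemD e) (hNE : NonElementary Γ) :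
    ∃ C : ℝ, 0 ≤ C ∧ ∃ F : Finset Γ, (∀ f ∈ F, d 1 f ≤ C ∧ e 1 f ≤ C) ∧ ∀ g h, ∃ f ∈ F,
      d 1 g + d 1 h ≤ d 1 (g * f * h) + C ∧ e 1 g + e 1 h ≤ e 1 (g * f * h) + C := by
  obtain ⟨δ, hδ⟩ := hd.hyp
  obtain ⟨C, hC⟩ := diverge hd hNE 2
  obtain ⟨r', hr0, hr'⟩ := star hd he (C + 2 * δ)
  obtain ⟨R, hR0, hR⟩ := finset_bound (hd.finite C).toFinset (e 1) (he.nn 1)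
  have hn := hδ.nonneg
  refine ⟨2 * |C| + 2 * δ + r' + R, by positivity, (hd.finite C).toFinset, ?_, ?_⟩
  · intro f hf
    have h1 := hR f hf
    simp only [Set.Finite.mem_toFinset, Set.mem_ofPred_eq] at hf
    have := le_abs_self C
    have := abs_nonneg C
    constructor <;> linarith
  · intro g h
    obtain ⟨f, hf1, hf2⟩ := hC h
    have : ∃ i : Fin 2, g2 d g⁻¹ (f i * h) ≤ C + 2 * δ := by
      by_contra hcon
      push Not at hcon
      have h0 := hcon 0
      have h1 := hcon 1
      rw [g2_symm hδ] at h0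
      rcases le_total (g2 d (f 0 * h) g⁻¹) (g2 d g⁻¹ (f 1 * h)) with q | q
      · have := g2_hyp hδ _ _ _ _ le_rfl q
        have := hf2 0 1 (by decide)
        linarith
      · have := g2_hyp hδ _ _ _ _ q le_rfl
        have := hf2 0 1 (by decide)
        linarith
    obtain ⟨i, hi⟩ := this
    have hmem : f i ∈ (hd.finite C).toFinset := by simpa using hf1 i
    refine ⟨f i, hmem, ?_⟩
    have e1 : g2 d g⁻¹ (f i * h) = d 1 g + d 1 (f i * h) - d 1 (g * (f i * h)) := by
      unfold g2; rw [hd.inv, hd.eq_one g⁻¹, inv_inv]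
    have k1 : d 1 g + d 1 (f i * h) ≤ d 1 (g * (f i * h)) + (C + 2 * δ) := by linarith
    have k2 := hr' _ _ k1
    have a1 := hd.one_mul_le (f i)⁻¹ (f i * h)
    have a2 := he.one_mul_le (f i)⁻¹ (f i * h)
    rw [inv_mul_cancel_left, hd.inv] at a1
    rw [inv_mul_cancel_left, he.inv] at a2
    have := hR _ hmem
    have := hf1 i
    have := le_abs_self C
    have := abs_nonneg C
    rw [mul_assoc]
    constructor <;> linarith

/-- bounded multiplicity of points near a geodesic, at a given distance -/
lemma mult {d : Γ → Γ → ℝ} (hd : MemD d) (r : ℝ) : ∃ M : ℕ, ∀ (k : Γ) (n : ℝ) (E : Finset Γ),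
    (∀ g ∈ E, |d 1 g - n| ≤ r ∧ d 1 g + d 1 (g⁻¹ * k) ≤ d 1 k + r) → E.card ≤ M := by
  obtain ⟨δ, hδ⟩ := hd.hyp
  have hn := hδ.nonneg
  refine ⟨(hd.finite (2 * |r| + (3 * (2 * |r|) + 2 * δ))).toFinset.card, fun k n E hE => ?_⟩
  rcases E.eq_empty_or_nonempty with rfl | ⟨g0, hg0⟩
  · simp
  refine Finset.card_le_card_of_injOn (fun g => g0⁻¹ * g) ?_ (fun a _ b _ h => by simpa using h)
  intro g hg
  simp only [Finset.mem_coe, Set.Finite.mem_toFinset, Set.mem_ofPred_eq]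
  rw [← hd.eq_one]
  obtain ⟨a1, a2⟩ := hE g0 hg0
  obtain ⟨b1, b2⟩ := hE g hg
  rw [← hd.eq_one] at a2 b2
  have a1 := abs_le.1 a1
  have b1 := abs_le.1 b1
  have h1 := le_abs_self r
  have h0 := abs_nonneg r
  have := order1 hδ (2 * |r|) k g0 g (by linarith) (by linarith) (by linarith)
  rw [abs_of_nonneg (by positivity : (0:ℝ) ≤ 2 * |r|)] at this
  linarith

lemma count {d : Γ → Γ → ℝ} (hd : MemD d) (hNE : NonElementary Γ) : ∃ C : ℝ, 0 ≤ C ∧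
    ∀ k : ℕ, ∃ n : ℝ, ∃ E : Finset Γ, E.card = k ∧ ∀ g ∈ E, |d 1 g - n| ≤ C := by
  classical
  obtain ⟨δ, hδ⟩ := hd.hyp
  have hn := hδ.nonneg
  obtain ⟨C, hC0, hC⟩ := split hd hd
  refine ⟨C, hC0, fun k => ?_⟩
  obtain ⟨Ck, hCk⟩ := diverge hd hNE k
  set n : ℝ := |Ck| + 3 * C + 2 * δ + 1 with hnn
  have hn0 : 0 ≤ n := by positivity
  obtain ⟨y, hy⟩ := hd.far hNE (n + |Ck|)
  obtain ⟨f, hf1, hf2⟩ := hCk y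
  have l := le_abs_self Ck
  have l0 := abs_nonneg Ck
  have hp : ∀ i, ∃ p, |d 1 p - n| ≤ C ∧ d 1 p + d 1 (p⁻¹ * (f i * y)) ≤ d 1 (f i * y) + C := by
    intro i
    have a1 := hd.one_mul_le (f i)⁻¹ (f i * y)
    rw [inv_mul_cancel_left, hd.inv] at a1
    have := hf1 i
    obtain ⟨p, h1, h2, -⟩ := hC (f i * y) n hn0 (by linarith)
    exact ⟨p, h1, h2⟩
  choose p hp1 hp2 using hp
  have hinj : Function.Injective p := by
    intro i j hij
    by_contra hne
    have h1 := hp2 i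
    have h2 := hp2 j
    rw [← hd.eq_one] at h1 h2
    rw [← hij] at h2
    have h3 := abs_le.1 (hp1 i)
    have q1 : 2 * n - 3 * C ≤ g2 d (f i * y) (p i) := by
      rw [g2_symm hδ]; unfold g2; linarith
    have q2 : 2 * n - 3 * C ≤ g2 d (p i) (f j * y) := by
      unfold g2; linarith
    have := g2_hyp hδ _ _ _ _ q1 q2
    have := hf2 i j hne
    linarith
  refine ⟨n, Finset.univ.image p, ?_, ?_⟩
  · rw [Finset.card_image_of_injective _ hinj]; simp
  · intro g hg
    obtain ⟨i, -, rfl⟩ := Finset.mem_image.1 hg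
    exact hp1 i

lemma fibsum {α β : Type*} [DecidableEq β] (P : Finset α) (J : α → β) (φ : α → ℝ) (ψ : β → ℝ) (c : ℝ) (m : ℕ)
    (hc : 0 ≤ c) (hψ : ∀ b, 0 ≤ ψ b) (h : ∀ p ∈ P, φ p ≤ c * ψ (J p))
    (hm : ∀ k, ∀ Q ⊆ P, (∀ p ∈ Q, J p = k) → Q.card ≤ m) :
    ∑ p ∈ P, φ p ≤ (m * c) * ∑ k ∈ P.image J, ψ k := by
  rw [← Finset.sum_fiberwise_of_maps_to (s := P) (t := P.image J) (g := J) (fun x hx => Finset.mem_image_of_mem _ hx),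
    Finset.mul_sum]
  refine Finset.sum_le_sum fun k _ => ?_
  have h1 : ∑ p ∈ P with J p = k, φ p ≤ ∑ p ∈ P with J p = k, c * ψ k := by
    refine Finset.sum_le_sum fun p hp => ?_
    rw [Finset.mem_filter] at hp
    rw [← hp.2]; exact h p hp.1
  refine h1.trans ?_
  rw [Finset.sum_const, nsmul_eq_mul]
  have h2 := hm k (P.filter (fun p => J p = k)) (Finset.filter_subset _ _) (fun p hp => (Finset.mem_filter.1 hp).2)
  have h3 : (((P.filter (fun p => J p = k)).card : ℕ) : ℝ) ≤ m := by exact_mod_cast h2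
  have := mul_le_mul_of_nonneg_right h3 (mul_nonneg hc (hψ k))
  linarith

/-- join map with bounded fibres over shells -/
lemma joinJ {d e : Γ → Γ → ℝ} (hd : MemD d) (he : MemD e) (hNE : NonElementary Γ) :
    ∃ C : ℝ, 0 ≤ C ∧ ∃ J : Γ → Γ → Γ, (∀ g h, |d 1 (J g h) - d 1 g - d 1 h| ≤ C ∧
      |e 1 (J g h) - e 1 g - e 1 h| ≤ C) ∧
      ∀ r : ℝ, ∃ M : ℕ, ∀ (n : ℝ) (k : Γ) (P : Finset (Γ × Γ)),
        (∀ p ∈ P, |d 1 p.1 - n| ≤ r ∧ J p.1 p.2 = k) → P.card ≤ M := by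
  classical
  obtain ⟨C, hC0, F, hF, hj⟩ := join hd he hNE
  choose f hf h1 h2 using hj
  refine ⟨C, hC0, fun g h => g * f g h * h, ?_, ?_⟩
  · intro g h
    have a1 := hd.one_mul_le (g * f g h) h
    have a2 := hd.one_mul_le g (f g h)
    have b1 := he.one_mul_le (g * f g h) h
    have b2 := he.one_mul_le g (f g h)
    have := hF _ (hf g h)
    have := h1 g h
    have := h2 g h
    constructor <;> rw [abs_le] <;> constructor <;> linarith
  · intro r
    obtain ⟨M, hM⟩ := mult hd (|r| + 2 * C)
    refine ⟨M * F.card, fun n k P hP => ?_⟩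
    have key : (P.image Prod.fst).card ≤ M := by
      refine hM k n _ ?_
      intro g hg
      obtain ⟨⟨g', h⟩, hp, rfl⟩ := Finset.mem_image.1 hg
      obtain ⟨q1, q2⟩ := hP _ hp
      dsimp only at q1 q2 ⊢
      have l := le_abs_self r
      refine ⟨by linarith, ?_⟩
      have e1 : g'⁻¹ * k = f g' h * h := by rw [← q2]; group
      rw [e1, ← q2]
      have := hd.one_mul_le (f g' h) h
      have := hF _ (hf g' h)
      have := h1 g' h
      have := abs_nonneg r
      linarith
    have : P.card ≤ ((P.image Prod.fst) ×ˢ F).card := by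
      refine Finset.card_le_card_of_injOn (fun p => (p.1, f p.1 p.2)) ?_ ?_
      · intro p hp
        exact Finset.mem_coe.2 (Finset.mem_product.2 ⟨Finset.mem_image.2 ⟨p, hp, rfl⟩, hf _ _⟩)
      · intro p hp q hq hpq
        simp only [Prod.mk.injEq] at hpq
        have q1 := (hP p hp).2
        have q2 := (hP q hq).2
        rw [← q2] at q1
        dsimp only at q1
        rw [hpq.2, hpq.1] at q1
        exact Prod.ext hpq.1 (by simpa using q1)
    rw [Finset.card_product] at this
    exact this.trans (Nat.mul_le_mul_right _ key)

structure Dat (d e : Γ → Γ → ℝ) : Prop where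
  hd : MemD d
  he : MemD e
  ne : NonElementary Γ

noncomputable def ww (d e : Γ → Γ → ℝ) (s t : ℝ) (g : Γ) : ℝ := Real.exp (-(s * e 1 g) - t * d 1 g)

lemma ww_pos (d e : Γ → Γ → ℝ) (s t : ℝ) (g : Γ) : 0 < ww d e s t g := Real.exp_pos _

lemma ww_nn (d e : Γ → Γ → ℝ) (s t : ℝ) (g : Γ) : 0 ≤ ww d e s t g := (Real.exp_pos _).le

/-- approximate multiplicativity, general form -/
lemma exp_cmp (s t R C a b : ℝ) (hs : |s| ≤ R) (ht : |t| ≤ R) (ha : |a| ≤ C) (hb : |b| ≤ C) :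
    s * a + t * b ≤ 2 * R * C := by
  have hR : 0 ≤ R := (abs_nonneg _).trans hs
  have h1 : |s * a| ≤ R * C := by rw [abs_mul]; exact mul_le_mul hs ha (abs_nonneg _) hR
  have h2 : |t * b| ≤ R * C := by rw [abs_mul]; exact mul_le_mul ht hb (abs_nonneg _) hR
  linarith [le_abs_self (s * a), le_abs_self (t * b)]

open Classical in
noncomputable def sh (d : Γ → Γ → ℝ) (n r : ℝ) : Finset Γ :=
  if h : {g : Γ | |d 1 g - n| ≤ r}.Finite then h.toFinset else ∅

lemma MemD.mem_sh {d : Γ → Γ → ℝ} (h : MemD d) {n r : ℝ} {g : Γ} : g ∈ sh d n r ↔ |d 1 g - n| ≤ r := by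
  have : {g : Γ | |d 1 g - n| ≤ r}.Finite := (h.finite (n + r)).subset fun g hg => by
    have := abs_le.1 (show |d 1 g - n| ≤ r from hg)
    show d 1 g ≤ n + r
    linarith
  unfold sh
  rw [dif_pos this]
  simp

/-- Products of sums over shells. -/
lemma Dat.JL {d e : Γ → Γ → ℝ} (H : Dat d e) : ∃ C : ℝ, 0 ≤ C ∧ ∀ r R : ℝ, ∃ K : ℝ, 0 < K ∧
    ∀ n s t : ℝ, |s| ≤ R → |t| ≤ R → ∀ T U : Finset Γ, (∀ g ∈ T, |d 1 g - n| ≤ r) →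
    ∃ I : Finset Γ, (∀ k ∈ I, ∃ g ∈ T, ∃ h ∈ U, |d 1 k - d 1 g - d 1 h| ≤ C ∧
      |e 1 k - e 1 g - e 1 h| ≤ C) ∧
      (∑ g ∈ T, ww d e s t g) * (∑ h ∈ U, ww d e s t h) ≤ K * ∑ k ∈ I, ww d e s t k := by
  classical
  obtain ⟨C, hC0, J, hJ, hfib⟩ := joinJ H.hd H.he H.ne
  refine ⟨C, hC0, fun r R => ?_⟩
  obtain ⟨M, hM⟩ := hfib r
  refine ⟨(M + 1 : ℕ) * Real.exp (2 * R * C), by positivity, fun n s t hs ht T U hT => ?_⟩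
  refine ⟨(T ×ˢ U).image (fun p => J p.1 p.2), ?_, ?_⟩
  · intro k hk
    obtain ⟨⟨g, h⟩, hp, rfl⟩ := Finset.mem_image.1 hk
    rw [Finset.mem_product] at hp
    exact ⟨g, hp.1, h, hp.2, hJ g h⟩
  · rw [Finset.sum_mul_sum, ← Finset.sum_product']
    refine fibsum (T ×ˢ U) (fun p => J p.1 p.2) (fun p => ww d e s t p.1 * ww d e s t p.2) (ww d e s t)
      (Real.exp (2 * R * C)) (M + 1) (Real.exp_pos _).le (ww_nn d e s t) ?_ ?_
    · intro p hp
      unfold ww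
      rw [← Real.exp_add, ← Real.exp_add]
      apply Real.exp_le_exp.2
      have := exp_cmp s t R C _ _ hs ht (hJ p.1 p.2).2 (hJ p.1 p.2).1
      linarith
    · intro k Q hQ hQk
      refine (hM n k Q fun p hp => ⟨hT _ ?_, hQk p hp⟩).trans (Nat.le_succ _)
      exact (Finset.mem_product.1 (hQ hp)).1

lemma Dat.up {d e : Γ → Γ → ℝ} (H : Dat d e) (r R : ℝ) : ∃ K : ℝ, 0 < K ∧
    ∀ n s t : ℝ, |s| ≤ R → |t| ≤ R → Summable (ww d e s t) → ∀ T : Finset Γ,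
      (∀ g ∈ T, |d 1 g - n| ≤ r) → ∑ g ∈ T, ww d e s t g ≤ K := by
  obtain ⟨C, hC0, hJL⟩ := H.JL
  obtain ⟨K, hK0, hK⟩ := hJL r R
  refine ⟨K, hK0, fun n s t hs ht hsum T hT => ?_⟩
  set W := ∑' g, ww d e s t g with hW
  have hWpos : 0 < W := hsum.tsum_pos (ww_nn d e s t) 1 (ww_pos d e s t 1)
  have h1 : ∀ U : Finset Γ, (∑ g ∈ T, ww d e s t g) * (∑ h ∈ U, ww d e s t h) ≤ K * W := by
    intro U
    obtain ⟨I, -, hI⟩ := hK n s t hs ht T U hT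
    exact hI.trans (mul_le_mul_of_nonneg_left (hsum.sum_le_tsum _ (fun g _ => ww_nn d e s t g)) hK0.le)
  have h2 : (∑ g ∈ T, ww d e s t g) * W ≤ K * W :=
    le_of_tendsto (Filter.Tendsto.const_mul _ hsum.hasSum) (Eventually.of_forall h1)
  exact le_of_mul_le_mul_right h2 hWpos

lemma Dat.crit {d e : Γ → Γ → ℝ} (H : Dat d e) : ∃ C : ℝ, 0 ≤ C ∧ ∀ n s t R : ℝ, 2 * C ≤ n →
    |s| ≤ R → |t| ≤ R →
    Real.exp (2 * R * C) * ∑ g ∈ sh d n C, ww d e s t g ≤ 1 / 2 → Summable (ww d e s t) := by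
  classical
  obtain ⟨C, hC0, hC⟩ := split H.hd H.he
  refine ⟨C, hC0, fun n s t R hn hs ht hle => ?_⟩
  set b : ℝ → Finset Γ := fun N => (H.hd.finite N).toFinset with hb
  have memb : ∀ N g, g ∈ b N ↔ d 1 g ≤ N := fun N g => by simp [hb]
  have hn0 : 0 ≤ n := by linarith
  have hsp : ∀ g : Γ, ∃ p, n < d 1 g → |d 1 p - n| ≤ C ∧ d 1 p + d 1 (p⁻¹ * g) ≤ d 1 g + C ∧
      e 1 p + e 1 (p⁻¹ * g) ≤ e 1 g + C := by
    intro g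
    by_cases h : n < d 1 g
    · obtain ⟨p, hp⟩ := hC g n hn0 h.le
      exact ⟨p, fun _ => hp⟩
    · exact ⟨1, fun h' => absurd h' h⟩
  choose p hp using hsp
  have main : ∀ N, ∑ g ∈ b N, ww d e s t g ≤ 2 * ∑ g ∈ b n, ww d e s t g := by
    intro N
    have h1 : ∑ g ∈ b N, ww d e s t g = ∑ g ∈ (b N).filter (fun g => d 1 g ≤ n), ww d e s t g +
        ∑ g ∈ (b N).filter (fun g => ¬ d 1 g ≤ n), ww d e s t g := (Finset.sum_filter_add_sum_filter_not _ _ _).symm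
    have h2 : ∑ g ∈ (b N).filter (fun g => d 1 g ≤ n), ww d e s t g ≤ ∑ g ∈ b n, ww d e s t g := by
      refine Finset.sum_le_sum_of_subset_of_nonneg ?_ (fun g _ _ => ww_nn d e s t g)
      intro g hg
      rw [memb]; exact (Finset.mem_filter.1 hg).2
    have h3 : ∑ g ∈ (b N).filter (fun g => ¬ d 1 g ≤ n), ww d e s t g ≤
        Real.exp (2 * R * C) * ((∑ g ∈ sh d n C, ww d e s t g) * ∑ g ∈ b N, ww d e s t g) := by
      rw [Finset.sum_mul_sum, ← Finset.sum_product', Finset.mul_sum]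
      have inj : Set.InjOn (fun g => (p g, (p g)⁻¹ * g)) (((b N).filter (fun g => ¬ d 1 g ≤ n) : Finset Γ) : Set Γ) := by
        intro g _ g' _ hgg
        simp only [Prod.mk.injEq] at hgg
        rw [hgg.1] at hgg
        simpa using hgg.2
      have : ∑ g ∈ (b N).filter (fun g => ¬ d 1 g ≤ n), ww d e s t g ≤
        ∑ g ∈ (b N).filter (fun g => ¬ d 1 g ≤ n), Real.exp (2 * R * C) * (ww d e s t (p g) * ww d e s t ((p g)⁻¹ * g)) := by
        refine Finset.sum_le_sum fun g hg => ?_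
        rw [Finset.mem_filter, not_le] at hg
        obtain ⟨q1, q2, q3⟩ := hp g hg.2
        have a1 := H.hd.one_mul_le (p g) ((p g)⁻¹ * g)
        have a2 := H.he.one_mul_le (p g) ((p g)⁻¹ * g)
        rw [mul_inv_cancel_left] at a1 a2
        unfold ww
        rw [← Real.exp_add, ← Real.exp_add]
        apply Real.exp_le_exp.2
        have := exp_cmp s t R C (e 1 (p g) + e 1 ((p g)⁻¹ * g) - e 1 g) (d 1 (p g) + d 1 ((p g)⁻¹ * g) - d 1 g) hs ht
          (abs_le.2 ⟨by linarith, by linarith⟩) (abs_le.2 ⟨by linarith, by linarith⟩)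
        linarith
      refine this.trans ?_
      rw [← Finset.sum_image (f := fun q : Γ × Γ => Real.exp (2 * R * C) * (ww d e s t q.1 * ww d e s t q.2)) inj]
      refine Finset.sum_le_sum_of_subset_of_nonneg ?_ (fun q _ _ => by
        have := ww_nn d e s t q.1
        have := ww_nn d e s t q.2
        positivity)
      intro q hq
      obtain ⟨g, hg, rfl⟩ := Finset.mem_image.1 hq
      rw [Finset.mem_filter, not_le, memb] at hg
      obtain ⟨q1, q2, q3⟩ := hp g hg.2
      rw [Finset.mem_product, H.hd.mem_sh, memb]
      refine ⟨q1, ?_⟩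
      have := abs_le.1 q1
      dsimp only
      linarith
    have hWnn : 0 ≤ ∑ g ∈ b N, ww d e s t g := Finset.sum_nonneg fun g _ => ww_nn d e s t g
    have h4 := mul_le_mul_of_nonneg_right hle hWnn
    linarith
  refine summable_of_sum_le (c := 2 * ∑ g ∈ b n, ww d e s t g) (ww_nn d e s t) fun u => ?_
  obtain ⟨N, hN0, hN⟩ := finset_bound u (d 1) (H.hd.nn 1)
  refine (Finset.sum_le_sum_of_subset_of_nonneg ?_ (fun g _ _ => ww_nn d e s t g)).trans (main N)
  intro g hg
  rw [memb]; exact hN g hg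

lemma MemD.comp {d e : Γ → Γ → ℝ} (hd : MemD d) (he : MemD e) : ∃ L C : ℝ, 0 ≤ L ∧ 0 ≤ C ∧
    ∀ g, e 1 g ≤ L * d 1 g + C := by
  obtain ⟨S, hS, -⟩ := hd.quasiIsom
  obtain ⟨L, C, hL, hC, hq⟩ := hd.qi hS
  obtain ⟨L', C', hL', hC', hq'⟩ := he.qi hS
  refine ⟨L' * L, L' * C, by positivity, by positivity, fun g => ?_⟩
  have := mul_le_mul_of_nonneg_left (hq g).2 hL'
  linarith [(hq' g).1]

lemma manh_def (d e : Γ → Γ → ℝ) (s : ℝ) : manhattan d e s = sInf {t | Summable (ww d e s t)} := rfl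

lemma Dat.mono {d e : Γ → Γ → ℝ} (H : Dat d e) {s t t' : ℝ} (h : Summable (ww d e s t)) (htt : t ≤ t') :
    Summable (ww d e s t') := by
  refine Summable.of_nonneg_of_le (ww_nn d e s t') (fun g => ?_) h
  unfold ww
  apply Real.exp_le_exp.2
  have := mul_le_mul_of_nonneg_right htt (H.hd.nn 1 g)
  linarith

lemma Dat.bddBelow {d e : Γ → Γ → ℝ} (H : Dat d e) : ∃ L : ℝ, 0 ≤ L ∧ ∀ s t, Summable (ww d e s t) →
    -(|s| * L) < t := by
  obtain ⟨L, C, hL, hC, hq⟩ := H.hd.comp H.he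
  refine ⟨L, hL, fun s t hs => ?_⟩
  by_contra hcon
  push Not at hcon
  have := H.ne.infinite
  have h2 : ∀ g, Real.exp (-(|s| * C)) ≤ ww d e s t g := by
    intro g
    apply Real.exp_le_exp.2
    have a1 := mul_le_mul_of_nonneg_right hcon (H.hd.nn 1 g)
    have a2 := mul_le_mul_of_nonneg_left (hq g) (abs_nonneg s)
    have a3 := mul_le_mul_of_nonneg_right (le_abs_self s) (H.he.nn 1 g)
    linarith
  have h3 : Summable (fun _ : Γ => Real.exp (-(|s| * C))) :=
    Summable.of_nonneg_of_le (fun _ => (Real.exp_pos _).le) h2 hs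
  rw [summable_const_iff] at h3
  exact (Real.exp_pos _).ne' h3

lemma Dat.exists_summable {d e : Γ → Γ → ℝ} (H : Dat d e) (s : ℝ) : ∃ t, Summable (ww d e s t) := by
  obtain ⟨C, hC0, hC⟩ := H.crit
  set n := 3 * C + 1 with hn
  set Q := ∑ g ∈ sh d n C, Real.exp (-(s * e 1 g)) with hQ
  have hQ0 : 0 ≤ Q := Finset.sum_nonneg fun _ _ => (Real.exp_pos _).le
  have hbd : ∀ t, |s| ≤ t → Real.exp (2 * t * C) * ∑ g ∈ sh d n C, ww d e s t g ≤ Real.exp (-t) * Q := by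
    intro t ht
    have ht0 : 0 ≤ t := (abs_nonneg s).trans ht
    rw [hQ, Finset.mul_sum, Finset.mul_sum]
    refine Finset.sum_le_sum fun g hg => ?_
    rw [H.hd.mem_sh, abs_le] at hg
    unfold ww
    rw [← Real.exp_add, ← Real.exp_add]
    apply Real.exp_le_exp.2
    have : t * (2 * C + 1) ≤ t * d 1 g := mul_le_mul_of_nonneg_left (by linarith) ht0
    linarith
  have hlim : Tendsto (fun t : ℝ => Real.exp (-t) * Q) atTop (nhds 0) := by
    have := (Real.tendsto_exp_neg_atTop_nhds_zero).mul_const Q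
    simpa using this
  obtain ⟨t, ht1, ht2⟩ := ((hlim.eventually (ge_mem_nhds (by norm_num : (0:ℝ) < 1/2))).and (eventually_ge_atTop |s|)).exists
  refine ⟨t, hC n s t t (by linarith) ht2 (by rw [abs_of_nonneg ((abs_nonneg s).trans ht2)]) ((hbd t ht2).trans ht1)⟩

lemma Dat.summable_of_lt {d e : Γ → Γ → ℝ} (H : Dat d e) {s t : ℝ} (h : manhattan d e s < t) :
    Summable (ww d e s t) := by
  rw [manh_def] at h
  obtain ⟨t', ht', h2⟩ := exists_lt_of_csInf_lt (H.exists_summable s) h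
  exact H.mono ht' h2.le

lemma Dat.le_of_summable {d e : Γ → Γ → ℝ} (H : Dat d e) {s t : ℝ} (h : Summable (ww d e s t)) :
    manhattan d e s ≤ t := by
  rw [manh_def]
  obtain ⟨L, -, hL⟩ := H.bddBelow
  exact csInf_le ⟨-(|s| * L), fun t' ht' => (hL s t' ht').le⟩ h

lemma Dat.convex {d e : Γ → Γ → ℝ} (H : Dat d e) : ConvexOn ℝ univ (manhattan d e) := by
  refine ⟨convex_univ, ?_⟩
  intro x _ y _ a b ha hb hab
  simp only [smul_eq_mul]
  refine le_of_forall_pos_le_add fun ε hε => ?_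
  have h1 := H.summable_of_lt (s := x) (t := manhattan d e x + ε) (by linarith)
  have h2 := H.summable_of_lt (s := y) (t := manhattan d e y + ε) (by linarith)
  have h3 : Summable (ww d e (a * x + b * y) (a * (manhattan d e x + ε) + b * (manhattan d e y + ε))) := by
    refine Summable.of_nonneg_of_le (ww_nn d e _ _) (fun g => ?_) ((h1.mul_left a).add (h2.mul_left b))
    have := convexOn_exp.2 (mem_univ (-(x * e 1 g) - (manhattan d e x + ε) * d 1 g))
      (mem_univ (-(y * e 1 g) - (manhattan d e y + ε) * d 1 g)) ha hb hab
    simp only [smul_eq_mul] at this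
    unfold ww
    refine le_trans (le_of_eq ?_) this
    congr 1; ring
  have := H.le_of_summable h3
  have e1 : a * (manhattan d e x + ε) + b * (manhattan d e y + ε) =
    a * manhattan d e x + b * manhattan d e y + (a + b) * ε := by ring
  rw [e1, hab, one_mul] at this
  exact this

lemma Dat.cont {d e : Γ → Γ → ℝ} (H : Dat d e) : Continuous (manhattan d e) := by
  have := H.convex.continuousOn isOpen_univ
  exact continuousOn_univ.1 this

lemma ww_cont (d e : Γ → Γ → ℝ) (s : ℝ) (T : Finset Γ) :
    Continuous (fun t => ∑ g ∈ T, ww d e s t g) := by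
  unfold ww; fun_prop

/-- upper Gibbs bound -/
lemma Dat.gup {d e : Γ → Γ → ℝ} (H : Dat d e) (r R : ℝ) : ∃ K : ℝ, 0 < K ∧
    ∀ n s : ℝ, |s| ≤ R → |manhattan d e s| ≤ R → ∀ T : Finset Γ,
      (∀ g ∈ T, |d 1 g - n| ≤ r) → ∑ g ∈ T, ww d e s (manhattan d e s) g ≤ K := by
  obtain ⟨K, hK0, hK⟩ := H.up r (R + 1)
  refine ⟨K, hK0, fun n s hs hm T hT => ?_⟩
  have h1 : Tendsto (fun t => ∑ g ∈ T, ww d e s t g) (nhdsWithin (manhattan d e s) (Ioi (manhattan d e s)))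
      (nhds (∑ g ∈ T, ww d e s (manhattan d e s) g)) := ((ww_cont d e s T).tendsto _).mono_left nhdsWithin_le_nhds
  refine le_of_tendsto h1 ?_
  have h2 : ∀ᶠ t in nhdsWithin (manhattan d e s) (Ioi (manhattan d e s)), t < manhattan d e s + 1 :=
    nhdsWithin_le_nhds (gt_mem_nhds (by linarith))
  filter_upwards [h2, self_mem_nhdsWithin] with t ht1 ht2
  have ht2 : manhattan d e s < t := ht2
  have := abs_le.1 hm
  exact hK n s t (by linarith) (abs_le.2 ⟨by linarith, by linarith⟩) (H.summable_of_lt ht2) T hT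

/-- lower Gibbs bound -/
lemma Dat.glo {d e : Γ → Γ → ℝ} (H : Dat d e) : ∃ C : ℝ, 0 ≤ C ∧ ∀ R : ℝ, ∃ c : ℝ, 0 < c ∧
    ∀ n s t : ℝ, |s| ≤ R → |t| ≤ R → t ≤ manhattan d e s → 2 * C ≤ n →
      c ≤ ∑ g ∈ sh d n C, ww d e s t g := by
  obtain ⟨C, hC0, hC⟩ := H.crit
  refine ⟨C, hC0, fun R => ⟨1 / 2 * Real.exp (-(2 * (R + 1) * C)), by positivity, fun n s t hs ht htm hn => ?_⟩⟩
  have h1 : Tendsto (fun t => ∑ g ∈ sh d n C, ww d e s t g) (nhdsWithin t (Iio t))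
      (nhds (∑ g ∈ sh d n C, ww d e s t g)) := ((ww_cont d e s _).tendsto _).mono_left nhdsWithin_le_nhds
  refine ge_of_tendsto h1 ?_
  have h2 : ∀ᶠ t' in nhdsWithin t (Iio t), t - 1 < t' :=
    nhdsWithin_le_nhds (lt_mem_nhds (by linarith))
  filter_upwards [h2, self_mem_nhdsWithin] with t' ht1 ht2
  have ht2 : t' < t := ht2
  have := abs_le.1 ht
  by_contra hcon
  push Not at hcon
  have : Summable (ww d e s t') := by
    refine hC n s t' (R + 1) hn (by linarith) (abs_le.2 ⟨by linarith, by linarith⟩) ?_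
    have := mul_le_mul_of_nonneg_left hcon.le (Real.exp_pos (2 * (R + 1) * C)).le
    refine this.trans (le_of_eq ?_)
    rw [mul_left_comm, ← Real.exp_add]; simp
  have := H.le_of_summable this
  linarith

lemma Dat.v_pos {d e : Γ → Γ → ℝ} (H : Dat d e) : 0 < manhattan d e 0 := by
  by_contra hcon
  push Not at hcon
  obtain ⟨C, hC0, hC⟩ := count H.hd H.ne
  obtain ⟨K, hK0, hK⟩ := H.up C 1
  obtain ⟨k, hk⟩ := exists_nat_gt K
  obtain ⟨n, E, hE, hE2⟩ := hC k
  have h1 : Tendsto (fun t => ∑ g ∈ E, ww d e 0 t g) (nhdsWithin 0 (Ioi 0))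
      (nhds (∑ g ∈ E, ww d e 0 0 g)) := ((ww_cont d e 0 E).tendsto _).mono_left nhdsWithin_le_nhds
  have h3 : ∑ g ∈ E, ww d e 0 0 g ≤ K := by
    refine le_of_tendsto h1 ?_
    have h2 : ∀ᶠ t in nhdsWithin (0:ℝ) (Ioi 0), t < 1 := nhdsWithin_le_nhds (gt_mem_nhds (by linarith))
    filter_upwards [h2, self_mem_nhdsWithin] with t ht1 ht2
    have ht2 : 0 < t := ht2
    exact hK n 0 t (by simp) (abs_le.2 ⟨by linarith, by linarith⟩) (H.summable_of_lt (by linarith)) E hE2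
  have h4 : ∑ g ∈ E, ww d e 0 0 g = k := by simp [ww, hE]
  linarith

lemma Dat.swap {d e : Γ → Γ → ℝ} (H : Dat d e) : Dat e d := ⟨H.he, H.hd, H.ne⟩

lemma MemD.ball_finite {d : Γ → Γ → ℝ} (h : MemD d) (T : ℝ) : (ball d T).Finite :=
  (h.finite T).subset fun g hg => le_of_lt (show d 1 g < T from hg)

lemma Dat.ball_up {d e : Γ → Γ → ℝ} (H : Dat d e) {s t : ℝ} (h : manhattan d e s < t) (ht : 0 ≤ t) :
    ∃ K : ℝ, 0 < K ∧ ∀ T, ∑ g ∈ (H.hd.ball_finite T).toFinset, Real.exp (-(s * e 1 g)) ≤ K * Real.exp (t * T) := by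
  have hs := H.summable_of_lt h
  refine ⟨∑' g, ww d e s t g, hs.tsum_pos (ww_nn d e s t) 1 (ww_pos d e s t 1), fun T => ?_⟩
  have h1 : ∑ g ∈ (H.hd.ball_finite T).toFinset, Real.exp (-(s * e 1 g)) ≤
      ∑ g ∈ (H.hd.ball_finite T).toFinset, ww d e s t g * Real.exp (t * T) := by
    refine Finset.sum_le_sum fun g hg => ?_
    have hg : d 1 g < T := by simpa [ball] using hg
    unfold ww
    rw [← Real.exp_add]
    apply Real.exp_le_exp.2
    have := mul_le_mul_of_nonneg_left hg.le ht
    linarith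
  refine h1.trans ?_
  rw [← Finset.sum_mul]
  exact mul_le_mul_of_nonneg_right (hs.sum_le_tsum _ (fun g _ => ww_nn d e s t g)) (Real.exp_pos _).le

lemma Dat.ball_lo {d e : Γ → Γ → ℝ} (H : Dat d e) :
    ∃ c : ℝ, 0 < c ∧ ∃ T0, ∀ T ≥ T0, c * Real.exp (manhattan d e 0 * T) ≤ (H.hd.ball_finite T).toFinset.card := by
  obtain ⟨C, hC0, hC⟩ := H.glo
  set v := manhattan d e 0 with hv
  have hv0 := H.v_pos
  obtain ⟨c, hc, hcc⟩ := hC v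
  refine ⟨c * Real.exp (-(v * (2 * C + 1))), by positivity, 3 * C + 1, fun T hT => ?_⟩
  have h1 := hcc (T - C - 1) 0 v (by simpa using hv0.le) (by rw [abs_of_pos hv0]) le_rfl (by linarith)
  have h2 : ∑ g ∈ sh d (T - C - 1) C, ww d e 0 v g ≤ ∑ g ∈ (H.hd.ball_finite T).toFinset, Real.exp (-(v * (T - (2 * C + 1)))) := by
    have hsub : sh d (T - C - 1) C ⊆ (H.hd.ball_finite T).toFinset := by
      intro g hg
      rw [H.hd.mem_sh, abs_le] at hg
      simp only [Set.Finite.mem_toFinset, ball, Set.mem_ofPred_eq]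
      linarith
    refine le_trans (Finset.sum_le_sum fun g hg => ?_) (Finset.sum_le_sum_of_subset_of_nonneg hsub (fun _ _ _ => (Real.exp_pos _).le))
    rw [H.hd.mem_sh, abs_le] at hg
    unfold ww
    apply Real.exp_le_exp.2
    have : v * (T - (2 * C + 1)) ≤ v * d 1 g := mul_le_mul_of_nonneg_left (by linarith) hv0.le
    linarith
  rw [Finset.sum_const, nsmul_eq_mul] at h2
  have h3 := h1.trans h2
  have e1 : c * Real.exp (-(v * (2 * C + 1))) * Real.exp (v * T) = c * Real.exp (v * (T - (2 * C + 1))) := by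
    rw [mul_assoc, ← Real.exp_add]; congr 2; ring
  rw [e1]
  have := mul_le_mul_of_nonneg_right h3 (Real.exp_pos (v * (T - (2 * C + 1)))).le
  rw [mul_assoc _ (Real.exp (-_)), ← Real.exp_add] at this
  simpa using this

lemma Dat.growth {d e : Γ → Γ → ℝ} (H : Dat d e) : growthRate d = manhattan d e 0 := by
  unfold growthRate
  apply Tendsto.limsup_eq
  set v := manhattan d e 0 with hv
  have hv0 : 0 < v := H.v_pos
  have hN : ∀ T, ((ball d T).ncard : ℝ) = (H.hd.ball_finite T).toFinset.card := by
    intro T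
    rw [Set.ncard_eq_toFinset_card _ (H.hd.ball_finite T)]
  have hev : ∀ (a : ℝ) (k : ℝ), 0 < k → ∀ᶠ T : ℝ in atTop, a < k * T := fun a k hk =>
    (tendsto_id.const_mul_atTop hk).eventually_gt_atTop a
  refine tendsto_order.2 ⟨fun a ha => ?_, fun b hb => ?_⟩
  · obtain ⟨c, hc, T0, hT0⟩ := H.ball_lo
    filter_upwards [eventually_ge_atTop T0, hev (-Real.log c) (v - a) (by linarith), eventually_gt_atTop 0] with T h1 h2 h3
    rw [lt_div_iff₀ h3, hN]
    have h4 := Real.log_le_log (by positivity) (hT0 T h1)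
    rw [Real.log_mul hc.ne' (Real.exp_pos _).ne', Real.log_exp] at h4
    linarith
  · obtain ⟨K, hK, hK2⟩ := H.ball_up (s := 0) (t := (v + b) / 2) (by linarith) (by linarith)
    filter_upwards [hev (Real.log K) ((b - v) / 2) (by linarith), eventually_gt_atTop 0] with T h2 h3
    rw [div_lt_iff₀ h3, hN]
    have h4 := hK2 T
    simp only [zero_mul, neg_zero, Real.exp_zero, Finset.sum_const, nsmul_eq_mul, mul_one] at h4
    have h1 : (1:Γ) ∈ (H.hd.ball_finite T).toFinset := by
      simp only [Set.Finite.mem_toFinset, ball, Set.mem_ofPred_eq]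
      rw [H.hd.isMetric.refl]; exact h3
    have h5 : (0:ℝ) < (H.hd.ball_finite T).toFinset.card := by
      exact_mod_cast Finset.card_pos.2 ⟨1, h1⟩
    have h6 := Real.log_le_log h5 h4
    rw [Real.log_mul hK.ne' (Real.exp_pos _).ne', Real.log_exp] at h6
    linarith

lemma ww_swap (d e : Γ → Γ → ℝ) (s t : ℝ) : ww d e s t = ww e d t s := by
  funext g; unfold ww; congr 1; ring

lemma Dat.zero {d e : Γ → Γ → ℝ} (H : Dat d e) : manhattan d e (manhattan e d 0) = 0 := by
  set u := manhattan e d 0 with hu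
  have h1 : ∀ s, u < s → manhattan d e s ≤ 0 := by
    intro s hs
    apply H.le_of_summable
    rw [ww_swap]
    exact H.swap.summable_of_lt hs
  have h2 : ∀ s, s < u → 0 ≤ manhattan d e s := by
    intro s hs
    by_contra hcon
    push Not at hcon
    have := H.summable_of_lt hcon
    rw [ww_swap] at this
    have := H.swap.le_of_summable this
    linarith
  apply le_antisymm
  · refine le_of_tendsto ((H.cont.tendsto u).mono_left (nhdsWithin_le_nhds (s := Ioi u))) ?_
    filter_upwards [self_mem_nhdsWithin] with s hs using h1 s hs
  · refine ge_of_tendsto ((H.cont.tendsto u).mono_left (nhdsWithin_le_nhds (s := Iio u))) ?_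
    filter_upwards [self_mem_nhdsWithin] with s hs using h2 s hs

/-- middle lemma -/
lemma middle (c C : ℝ) (hc : 0 < c) (hC : 0 < C) : ∃ Λ c1 : ℝ, 0 < Λ ∧ 0 < c1 ∧
    ∀ (T : Finset Γ) (m Y : Γ → ℝ), (∀ g, 0 ≤ m g) → ∑ g ∈ T, m g ≤ C →
      ∑ g ∈ T, m g * Real.exp (2 * Y g) ≤ C → c ≤ ∑ g ∈ T, m g * Real.exp (Y g) →
      c1 ≤ ∑ g ∈ T with |Y g| ≤ Λ, m g := by
  set Λ : ℝ := |Real.log (c / (4 * C))| + 1 with hΛ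
  have hΛ0 : 0 < Λ := by positivity
  have hsm : Real.exp (-Λ) * C ≤ c / 4 := by
    have h1 : Real.exp (-Λ) ≤ c / (4 * C) := by
      rw [← Real.le_log_iff_exp_le (by positivity)]
      have := neg_abs_le (Real.log (c / (4 * C)))
      linarith
    have := mul_le_mul_of_nonneg_right h1 hC.le
    refine this.trans (le_of_eq ?_)
    field_simp
  refine ⟨Λ, (c / 2) * Real.exp (-Λ), hΛ0, by positivity, fun T m Y hm h0 h2 h1 => ?_⟩
  have e1 : ∑ g ∈ T, m g * Real.exp (Y g) = ∑ g ∈ T with |Y g| ≤ Λ, m g * Real.exp (Y g) +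
      ∑ g ∈ T with ¬ |Y g| ≤ Λ, m g * Real.exp (Y g) := (Finset.sum_filter_add_sum_filter_not _ _ _).symm
  have b1 : ∑ g ∈ T with ¬ |Y g| ≤ Λ, m g * Real.exp (Y g) ≤
      ∑ g ∈ T, (Real.exp (-Λ) * (m g) + Real.exp (-Λ) * (m g * Real.exp (2 * Y g))) := by
    refine le_trans (Finset.sum_le_sum fun g hg => ?_) (Finset.sum_le_sum_of_subset_of_nonneg (Finset.filter_subset _ _) ?_)
    · rw [Finset.mem_filter, not_le] at hg
      have key : Real.exp (Y g) ≤ Real.exp (-Λ) + Real.exp (-Λ) * Real.exp (2 * Y g) := by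
        rcases lt_abs.1 hg.2 with h | h
        · have : Real.exp (Y g) ≤ Real.exp (-Λ) * Real.exp (2 * Y g) := by
            rw [← Real.exp_add]; apply Real.exp_le_exp.2; linarith
          have := Real.exp_pos (-Λ); linarith
        · have : Real.exp (Y g) ≤ Real.exp (-Λ) := by
            apply Real.exp_le_exp.2; linarith
          have : 0 < Real.exp (-Λ) * Real.exp (2 * Y g) := by positivity
          linarith
      have := mul_le_mul_of_nonneg_left key (hm g)
      linarith
    · intro g _ _
      have := hm g
      positivity
  rw [Finset.sum_add_distrib, ← Finset.mul_sum, ← Finset.mul_sum] at b1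
  have b2 := mul_le_mul_of_nonneg_left h0 (Real.exp_pos (-Λ)).le
  have b3 := mul_le_mul_of_nonneg_left h2 (Real.exp_pos (-Λ)).le
  have b4 : ∑ g ∈ T with |Y g| ≤ Λ, m g * Real.exp (Y g) ≤ (∑ g ∈ T with |Y g| ≤ Λ, m g) * Real.exp Λ := by
    rw [Finset.sum_mul]
    refine Finset.sum_le_sum fun g hg => ?_
    rw [Finset.mem_filter] at hg
    exact mul_le_mul_of_nonneg_left (Real.exp_le_exp.2 ((le_abs_self _).trans hg.2)) (hm g)
  have b5 : c / 2 ≤ (∑ g ∈ T with |Y g| ≤ Λ, m g) * Real.exp Λ := by linarith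
  have b6 := mul_le_mul_of_nonneg_right b5 (Real.exp_pos (-Λ)).le
  rw [mul_assoc _ (Real.exp Λ), ← Real.exp_add] at b6
  simpa using b6

lemma Dat.halfset {d e : Γ → Γ → ℝ} (H : Dat d e) (σ m : ℝ) (hσ : |σ| = 1)
    (hder : ∀ η > 0, ∃ h0 > 0, ∀ h, 0 < h → h < h0 →
      |manhattan d e (σ * h) - manhattan d e 0 + σ * m * h| ≤ η * h) :
    ∃ C c1 : ℝ, 0 ≤ C ∧ 0 < c1 ∧ ∀ ε > 0, ∃ n0, ∀ n ≥ n0, ∃ G : Finset Γ,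
      (∀ g ∈ G, |d 1 g - n| ≤ C ∧ |e 1 g - m * n| ≤ ε * n) ∧
      c1 ≤ ∑ g ∈ G, ww d e 0 (manhattan d e 0) g := by
  set θ := manhattan d e with hθ
  set v := θ 0 with hv
  obtain ⟨C, hC0, hlo⟩ := H.glo
  set R : ℝ := |v| + |m| + 2 with hR
  obtain ⟨c, hc, hlo⟩ := hlo R
  obtain ⟨K, hK, hup⟩ := H.gup C R
  obtain ⟨Λ, c1, hΛ, hc1, hmid⟩ := middle (Γ := Γ) (Real.exp (-2) * c) (Real.exp 2 * K) (by positivity) (by positivity)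
  refine ⟨C, c1, hC0, hc1, fun ε hε => ?_⟩
  set lam := Λ / ε with hlam
  have hlam0 : 0 < lam := by positivity
  obtain ⟨h0, hh0, hder⟩ := hder (min 1 (1 / (4 * lam))) (by positivity)
  have hR0 : 0 ≤ R := by positivity
  refine ⟨2 * C + 1 + 2 * lam / h0 + 1 + 2 * lam + 2 * lam * |m| * C, fun n hn => ?_⟩
  have p1 : 0 ≤ 2 * lam / h0 := by positivity
  have p2 : 0 ≤ 2 * lam * |m| * C := by positivity
  have hn0 : 0 < n := by linarith
  set h := lam / n with hh
  have hpos : 0 < h := by positivity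
  have hhn : h * n = lam := by rw [hh]; field_simp
  have hb1 : 2 * h < h0 := by
    have : 2 * lam / h0 < n := by linarith
    rw [div_lt_iff₀ hh0] at this
    rw [hh, ← mul_div_assoc, div_lt_iff₀ hn0]; linarith
  have hb2 : 2 * h ≤ 1 := by
    rw [hh, ← mul_div_assoc, div_le_iff₀ hn0]; linarith
  have hb3 : 2 * h * |m| * C ≤ 1 := by
    have : 2 * h * |m| * C = (2 * lam * |m| * C) / n := by rw [hh]; ring
    rw [this, div_le_iff₀ hn0]; linarith
  have cmp : ∀ x, 0 < x → x ≤ 2 * h → |σ * x| ≤ R ∧ |θ (σ * x)| ≤ R ∧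
      ∀ g, |d 1 g - n| ≤ C → |(-(v * d 1 g) - σ * x * (e 1 g - m * n)) - (-(σ * x * e 1 g) - θ (σ * x) * d 1 g)| ≤ 2 := by
    intro x hx hx2
    have q := hder x hx (by linarith)
    have qa : |θ (σ * x) - v + σ * m * x| ≤ 1 * x :=
      q.trans (mul_le_mul_of_nonneg_right (min_le_left _ _) hx.le)
    have qb : |θ (σ * x) - v + σ * m * x| ≤ 1 / (4 * lam) * x :=
      q.trans (mul_le_mul_of_nonneg_right (min_le_right _ _) hx.le)
    have s1 : |σ * x| = x := by rw [abs_mul, hσ, one_mul, abs_of_pos hx]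
    have s2 : |σ * m * x| = |m| * x := by rw [abs_mul, abs_mul, hσ, one_mul, abs_of_pos hx]
    have s3 : |m| * x ≤ |m| := by
      have := mul_le_mul_of_nonneg_left (show x ≤ 1 by linarith) (abs_nonneg m); linarith
    refine ⟨?_, ?_, ?_⟩
    · rw [s1]; have := abs_nonneg v; have := abs_nonneg m; linarith
    · have e1 : θ (σ * x) = (θ (σ * x) - v + σ * m * x) + v - σ * m * x := by ring
      rw [e1]
      have := abs_sub ((θ (σ * x) - v + σ * m * x) + v) (σ * m * x)
      have := abs_add_le (θ (σ * x) - v + σ * m * x) v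
      linarith
    · intro g hg
      have hg' := abs_le.1 hg
      have e1 : (-(v * d 1 g) - σ * x * (e 1 g - m * n)) - (-(σ * x * e 1 g) - θ (σ * x) * d 1 g)
        = (θ (σ * x) - v + σ * m * x) * d 1 g - σ * m * x * (d 1 g - n) := by ring
      rw [e1]
      have a1 := abs_sub ((θ (σ * x) - v + σ * m * x) * d 1 g) (σ * m * x * (d 1 g - n))
      rw [abs_mul, abs_mul (σ * m * x), s2] at a1
      have a2 : |m| * x * |d 1 g - n| ≤ |m| * (2 * h) * C :=
        mul_le_mul (mul_le_mul_of_nonneg_left hx2 (abs_nonneg _)) hg (abs_nonneg _) (by positivity)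
      have a3 : |θ (σ * x) - v + σ * m * x| * |d 1 g| ≤ 1 / (4 * lam) * (2 * h) * (2 * n) := by
        refine mul_le_mul (qb.trans (mul_le_mul_of_nonneg_left hx2 (by positivity))) ?_ (abs_nonneg _) (by positivity)
        rw [abs_of_nonneg (H.hd.nn 1 g)]; linarith
      have a4 : 1 / (4 * lam) * (2 * h) * (2 * n) = 1 := by
        have : 1 / (4 * lam) * (2 * h) * (2 * n) = (h * n) / lam := by field_simp; ring
        rw [this, hhn, div_self hlam0.ne']
      linarith
  have hm := hmid (sh d n C) (ww d e 0 v) (fun g => - (σ * h * (e 1 g - m * n))) (ww_nn d e 0 v) ?_ ?_ ?_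
  · refine ⟨_, ?_, hm⟩
    intro g hg
    rw [Finset.mem_filter, H.hd.mem_sh, abs_neg, abs_mul, abs_mul, hσ, one_mul, abs_of_pos hpos] at hg
    refine ⟨hg.1, ?_⟩
    have h2 := hg.2
    have e1 : Λ = h * (ε * n) := by
      rw [hh, hlam]; field_simp
    rw [e1] at h2
    exact le_of_mul_le_mul_left h2 hpos
  · have := hup n 0 (by simpa using hR0) (by show |v| ≤ R; have := abs_nonneg m; linarith) (sh d n C) (fun g hg => H.hd.mem_sh.1 hg)
    have h1 : 1 ≤ Real.exp 2 := Real.one_le_exp (by norm_num)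
    have h2 := mul_le_mul_of_nonneg_right h1 hK.le
    exact this.trans (by linarith)
  · obtain ⟨q1, q2, q3⟩ := cmp (2 * h) (by positivity) le_rfl
    have := hup n (σ * (2 * h)) q1 q2 (sh d n C) (fun g hg => H.hd.mem_sh.1 hg)
    refine le_trans ?_ (mul_le_mul_of_nonneg_left this (Real.exp_pos 2).le)
    rw [Finset.mul_sum]
    refine Finset.sum_le_sum fun g hg => ?_
    have := abs_le.1 (q3 g (H.hd.mem_sh.1 hg))
    unfold ww
    rw [← Real.exp_add, ← Real.exp_add]
    apply Real.exp_le_exp.2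
    linarith [this.2]
  · obtain ⟨q1, q2, q3⟩ := cmp h (by positivity) (by linarith)
    have := hlo n (σ * h) (θ (σ * h)) q1 q2 le_rfl (by linarith)
    refine le_trans (mul_le_mul_of_nonneg_left this (Real.exp_pos (-2)).le) ?_
    rw [Finset.mul_sum]
    refine Finset.sum_le_sum fun g hg => ?_
    have := abs_le.1 (q3 g (H.hd.mem_sh.1 hg))
    unfold ww
    rw [← Real.exp_add, ← Real.exp_add]
    apply Real.exp_le_exp.2
    linarith [this.1]

lemma Dat.no_corner {d e : Γ → Γ → ℝ} (H : Dat d e) (a b : ℝ) (hab : b < a)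
    (ha : ∃ C c1 : ℝ, 0 ≤ C ∧ 0 < c1 ∧ ∀ ε > 0, ∃ n0, ∀ n ≥ n0, ∃ G : Finset Γ,
      (∀ g ∈ G, |d 1 g - n| ≤ C ∧ |e 1 g - a * n| ≤ ε * n) ∧
      c1 ≤ ∑ g ∈ G, ww d e 0 (manhattan d e 0) g)
    (hb : ∃ C c1 : ℝ, 0 ≤ C ∧ 0 < c1 ∧ ∀ ε > 0, ∃ n0, ∀ n ≥ n0, ∃ G : Finset Γ,
      (∀ g ∈ G, |d 1 g - n| ≤ C ∧ |e 1 g - b * n| ≤ ε * n) ∧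
      c1 ≤ ∑ g ∈ G, ww d e 0 (manhattan d e 0) g) : False := by
  classical
  set v := manhattan d e 0 with hv
  obtain ⟨Ca, ca, hCa, hca, ha⟩ := ha
  obtain ⟨Cb, cb, hCb, hcb, hb⟩ := hb
  obtain ⟨C, hC0, hJL⟩ := H.JL
  obtain ⟨K, hK, hJL⟩ := hJL Ca |v|
  obtain ⟨K2, hK2, hup⟩ := H.gup (Ca + Cb + C) |v|
  obtain ⟨N, hN⟩ := exists_nat_gt (K2 * K / (ca * cb))
  have hNpos : (0:ℝ) < N := lt_trans' hN (by positivity)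
  set Δ := a - b with hΔ
  have hΔ0 : 0 < Δ := by linarith
  set ε := Δ / (8 * (N + 1)) with hε
  have hε0 : 0 < ε := by positivity
  obtain ⟨na, ha⟩ := ha ε hε0
  obtain ⟨nb, hb⟩ := hb ε hε0
  set q : ℝ := |na| + |nb| + 4 * C / Δ + 1 with hq
  have hq0 : 0 < q := by positivity
  have hq1 : 4 * C < q * Δ := by
    have : 4 * C / Δ < q := by have := abs_nonneg na; have := abs_nonneg nb; linarith
    rwa [div_lt_iff₀ hΔ0] at this
  have hG : ∀ i : ℕ, ∃ I : Finset Γ, i < N → (∀ k ∈ I, |d 1 k - (N + 1) * q| ≤ Ca + Cb + C ∧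
      |e 1 k - (a * ((i + 1) * q) + b * ((N - i) * q))| ≤ ε * ((N + 1) * q) + C) ∧
      ca * cb ≤ K * ∑ k ∈ I, ww d e 0 v k := by
    intro i
    by_cases hi : i < N
    swap
    · exact ⟨∅, fun h => absurd h hi⟩
    have hi' : (i:ℝ) + 1 ≤ N := by exact_mod_cast hi
    have hi0 : (0:ℝ) ≤ i := Nat.cast_nonneg _
    have b1 : q ≤ (i + 1) * q := by nlinarith
    have b2 : q ≤ (N - i) * q := by nlinarith
    have r0 : 0 ≤ 4 * C / Δ := by positivity
    obtain ⟨G, hG, hGs⟩ := ha ((i + 1) * q) (by have := le_abs_self na; have := abs_nonneg nb; show na ≤ _; linarith)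
    obtain ⟨G', hG', hGs'⟩ := hb ((N - i) * q) (by have := le_abs_self nb; have := abs_nonneg na; show nb ≤ _; linarith)
    obtain ⟨I, hI, hIs⟩ := hJL ((i + 1) * q) 0 v (by simp) le_rfl G G' (fun g hg => (hG g hg).1)
    refine ⟨I, fun _ => ⟨?_, ?_⟩⟩
    · intro k hk
      obtain ⟨g, hg, g', hg', k1, k2⟩ := hI k hk
      obtain ⟨u1, u2⟩ := hG g hg
      obtain ⟨u3, u4⟩ := hG' g' hg'
      have k1 := abs_le.1 k1
      have k2 := abs_le.1 k2
      have u1 := abs_le.1 u1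
      have u2 := abs_le.1 u2
      have u3 := abs_le.1 u3
      have u4 := abs_le.1 u4
      refine ⟨abs_le.2 ⟨?_, ?_⟩, abs_le.2 ⟨?_, ?_⟩⟩ <;> linarith
    · refine le_trans (mul_le_mul hGs hGs' hcb.le ?_) hIs
      exact Finset.sum_nonneg fun g _ => ww_nn d e 0 v g
  choose I hI using hG
  have hdisj : Set.PairwiseDisjoint ((Finset.range N : Finset ℕ) : Set ℕ) I := by
    have aux : ∀ i j, i < N → j < N → i < j → Disjoint (I i) (I j) := by
      intro i j hi hj hij
      rw [Finset.disjoint_left]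
      intro k hk hk'
      have u1 := abs_le.1 ((hI i hi).1 k hk).2
      have u2 := abs_le.1 ((hI j hj).1 k hk').2
      have hij' : (i:ℝ) + 1 ≤ j := by exact_mod_cast hij
      have e1 : ε * ((N + 1) * q) = q * Δ / 8 := by rw [hε]; field_simp
      rw [e1] at u1 u2
      have e2 : (a * ((j + 1) * q) + b * ((N - j) * q)) - (a * ((i + 1) * q) + b * ((N - i) * q)) = ((j:ℝ) - i) * (q * Δ) := by
        rw [hΔ]; ring
      have : 1 * (q * Δ) ≤ ((j:ℝ) - i) * (q * Δ) := mul_le_mul_of_nonneg_right (by linarith) (by positivity)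
      linarith
    intro i hi j hj hij
    rw [Finset.mem_coe, Finset.mem_range] at hi hj
    rcases lt_or_gt_of_ne hij with h | h
    · exact aux i j hi hj h
    · exact (aux j i hj hi h).symm
  have h1 := hup ((N + 1) * q) 0 (by simp) le_rfl ((Finset.range N).biUnion I) (by
    intro g hg
    obtain ⟨i, hi, hg⟩ := Finset.mem_biUnion.1 hg
    exact ((hI i (Finset.mem_range.1 hi)).1 g hg).1)
  rw [Finset.sum_biUnion hdisj] at h1
  have h2 : ∑ i ∈ Finset.range N, ca * cb ≤ ∑ i ∈ Finset.range N, K * ∑ k ∈ I i, ww d e 0 v k :=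
    Finset.sum_le_sum fun i hi => (hI i (Finset.mem_range.1 hi)).2
  rw [Finset.sum_const, nsmul_eq_mul, Finset.card_range, ← Finset.mul_sum] at h2
  rw [div_lt_iff₀ (by positivity)] at hN
  have h3 := mul_le_mul_of_nonneg_left h1 hK.le
  linarith

lemma der_aux {f : ℝ → ℝ} {D σ : ℝ} (hσ : |σ| = 1) (S : Set ℝ) (hS : ∀ h > 0, σ * h ∈ S)
    (h : HasDerivWithinAt f D S 0) : ∀ η > 0, ∃ h0 > 0, ∀ h, 0 < h → h < h0 →
      |f (σ * h) - f 0 + σ * (-D) * h| ≤ η * h := by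
  intro η hη
  have h1 := (hasDerivWithinAt_iff_isLittleO.1 h).def hη
  rw [eventually_nhdsWithin_iff, Metric.eventually_nhds_iff] at h1
  obtain ⟨h0, hh0, h1⟩ := h1
  refine ⟨h0, hh0, fun x hx hx2 => ?_⟩
  have s1 : |σ * x| = x := by rw [abs_mul, hσ, one_mul, abs_of_pos hx]
  have := h1 (y := σ * x) (by rw [Real.dist_eq, sub_zero, s1]; exact hx2) (hS x hx)
  rw [sub_zero, Real.norm_eq_abs, Real.norm_eq_abs, s1, smul_eq_mul] at this
  convert this using 2
  ring

lemma Dat.diff {d e : Γ → Γ → ℝ} (H : Dat d e) : HasDerivAt (manhattan d e) (deriv (manhattan d e) 0) 0 := by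
  set θ := manhattan d e
  have hin : (0:ℝ) ∈ interior (univ : Set ℝ) := by simp
  have hr := H.convex.hasDerivWithinAt_rightDeriv_of_mem_interior hin
  have hl := H.convex.hasDerivWithinAt_leftDeriv_of_mem_interior hin
  have hle := H.convex.leftDeriv_le_rightDeriv_of_mem_interior hin
  rcases hle.eq_or_lt with h | h
  · rw [← h] at hr
    have h1 := (hasDerivWithinAt_Iio_iff_Iic.1 hl).union (hasDerivWithinAt_Ioi_iff_Ici.1 hr)
    rw [Iic_union_Ici, hasDerivWithinAt_univ] at h1
    exact h1.differentiableAt.hasDerivAt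
  · exfalso
    have A := H.halfset (-1) _ (by simp) (der_aux (by simp) _ (fun h hh => by simpa using hh) hl)
    have B := H.halfset 1 _ (by simp) (der_aux (by simp) _ (fun h hh => by simpa using hh) hr)
    exact H.no_corner _ _ (by linarith) A B

lemma jensen_aux {ι : Type*} (F : Finset ι) (φ : ι → ℝ) (m : ℝ) (hm : ∑ i ∈ F, φ i = F.card * m) :
    F.card * Real.exp m ≤ ∑ i ∈ F, Real.exp (φ i) := by
  have h1 : ∀ i ∈ F, Real.exp m * (φ i - m + 1) ≤ Real.exp (φ i) := by
    intro i _
    have h := mul_le_mul_of_nonneg_left (Real.add_one_le_exp (φ i - m)) (Real.exp_pos m).le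
    rwa [← Real.exp_add, add_sub_cancel] at h
  refine le_trans (le_of_eq ?_) (Finset.sum_le_sum h1)
  rw [← Finset.mul_sum, Finset.sum_add_distrib, Finset.sum_sub_distrib, hm]
  simp
  ring

lemma Dat.mean_side {d e : Γ → Γ → ℝ} (H : Dat d e) (σ : ℝ) (hσ : |σ| = 1) (η : ℝ) (hη : 0 < η) :
    ∀ᶠ T : ℝ in atTop, -σ * ((((ball d T).ncard : ℝ))⁻¹ * ∑ᶠ g ∈ ball d T, e 1 g / T - (- deriv (manhattan d e) 0)) < 3 * η := by
  set θ := manhattan d e with hθ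
  set τ := - deriv θ 0 with hτ
  have hv := H.v_pos
  set v := θ 0 with hvd
  obtain ⟨h0, hh0, hder⟩ := der_aux (f := θ) hσ univ (fun _ _ => mem_univ _) (hasDerivWithinAt_univ.2 H.diff) η hη
  obtain ⟨h, hh, hh1, hh2⟩ : ∃ h, 0 < h ∧ h < h0 ∧ |τ| * h ≤ v := by
    refine ⟨min (h0 / 2) (v / (|τ| + 1)), by positivity, lt_of_le_of_lt (min_le_left _ _) (by linarith), ?_⟩
    have := min_le_right (h0 / 2) (v / (|τ| + 1))
    calc |τ| * min (h0 / 2) (v / (|τ| + 1)) ≤ (|τ| + 1) * (v / (|τ| + 1)) := by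
          apply mul_le_mul (by linarith) this (by positivity) (by positivity)
      _ = v := by field_simp
  have hd := abs_le.1 (hder h hh hh1)
  have ht0 : 0 ≤ v - σ * τ * h + 2 * η * h := by
    have : |σ * τ * h| ≤ v := by rw [abs_mul, abs_mul, hσ, one_mul, abs_of_pos hh]; exact hh2
    have := (abs_le.1 this).2
    have : 0 < η * h := by positivity
    linarith
  obtain ⟨K, hK, hup⟩ := H.ball_up (s := σ * h) (t := v - σ * τ * h + 2 * η * h) (by
    have : 0 < η * h := by positivity
    show θ (σ * h) < _
    have := hd.2
    rw [← hτ] at this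
    linarith) ht0
  obtain ⟨c, hc, T0, hlo⟩ := H.ball_lo
  have hev : ∀ (a : ℝ) (k : ℝ), 0 < k → ∀ᶠ T : ℝ in atTop, a < k * T := fun a k hk =>
    (tendsto_id.const_mul_atTop hk).eventually_gt_atTop a
  filter_upwards [eventually_ge_atTop T0, hev (Real.log K - Real.log c) (η * h) (by positivity), eventually_gt_atTop 0] with T h1 h2 h3
  set F := (H.hd.ball_finite T).toFinset with hF
  have hN : ((ball d T).ncard : ℝ) = F.card := by
    rw [Set.ncard_eq_toFinset_card _ (H.hd.ball_finite T)]
  have hNpos : (0:ℝ) < F.card := lt_of_lt_of_le (by positivity) (hlo T h1)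
  have hsum : ∑ᶠ g ∈ ball d T, e 1 g / T = (∑ g ∈ F, e 1 g) / T := by
    rw [finsum_mem_eq_finite_toFinset_sum _ (H.hd.ball_finite T), Finset.sum_div]
  rw [hN, hsum]
  set E := (F.card : ℝ)⁻¹ * ∑ g ∈ F, e 1 g with hE
  have hE2 : (F.card : ℝ)⁻¹ * ((∑ g ∈ F, e 1 g) / T) = E / T := by rw [hE]; ring
  rw [hE2]
  have hj := jensen_aux F (fun g => -(σ * h * e 1 g)) (-(σ * h * E)) (by
    rw [Finset.sum_neg_distrib, ← Finset.mul_sum, hE]; field_simp)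
  have hj2 : c * Real.exp (v * T) * Real.exp (-(σ * h * E)) ≤ K * Real.exp ((v - σ * τ * h + 2 * η * h) * T) :=
    (mul_le_mul_of_nonneg_right (hlo T h1) (Real.exp_pos _).le).trans (hj.trans (hup T))
  have hj3 := Real.log_le_log (by positivity) hj2
  rw [Real.log_mul (by positivity) (by positivity), Real.log_mul (by positivity) (by positivity), Real.log_mul (by positivity) (by positivity),
    Real.log_exp, Real.log_exp, Real.log_exp] at hj3
  have e1 : -σ * (E / T - τ) = (-(σ * h * E) + σ * τ * h * T) / (h * T) := by field_simp; ring
  rw [e1, div_lt_iff₀ (by positivity)]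
  linarith

lemma Dat.mean {d e : Γ → Γ → ℝ} (H : Dat d e) : IsMeanDistortion d e (- deriv (manhattan d e) 0) := by
  unfold IsMeanDistortion
  rw [Metric.tendsto_nhds]
  intro ε hε
  filter_upwards [H.mean_side 1 (by simp) (ε / 3) (by positivity), H.mean_side (-1) (by simp) (ε / 3) (by positivity)] with T h1 h2
  rw [Real.dist_eq, abs_lt]
  constructor <;> linarith

lemma Dat.vs {d e : Γ → Γ → ℝ} (H : Dat d e) : growthRate e = manhattan e d 0 ∧ 0 < manhattan e d 0 :=
  ⟨H.swap.growth, H.swap.v_pos⟩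

lemma Dat.tangent {d e : Γ → Γ → ℝ} (H : Dat d e) (s : ℝ) :
    manhattan d e 0 + deriv (manhattan d e) 0 * s ≤ manhattan d e s := by
  rcases lt_trichotomy s 0 with h | h | h
  · have := H.convex.slope_le_of_hasDerivAt (mem_univ s) (mem_univ 0) h H.diff
    rw [slope_def_field, div_le_iff₀ (by linarith)] at this
    linarith
  · simp [h]
  · have := H.convex.le_slope_of_hasDerivAt (mem_univ 0) (mem_univ s) h H.diff
    rw [slope_def_field, le_div_iff₀ (by linarith)] at this
    linarith

lemma Dat.tau_ge {d e : Γ → Γ → ℝ} (H : Dat d e) :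
    growthRate d / growthRate e ≤ - deriv (manhattan d e) 0 := by
  rw [H.growth, H.vs.1, div_le_iff₀ H.vs.2]
  have := H.tangent (manhattan e d 0)
  rw [H.zero] at this
  linarith

lemma Dat.tau_pos {d e : Γ → Γ → ℝ} (H : Dat d e) : 0 < - deriv (manhattan d e) 0 := by
  refine lt_of_lt_of_le ?_ H.tau_ge
  rw [H.growth, H.vs.1]
  exact div_pos H.v_pos H.vs.2

/-- `k` has a copy of `g0` inserted roughly at position `n`. -/
def Ins (d e : Γ → Γ → ℝ) (r : ℝ) (g0 : Γ) (n n' : ℝ) (k : Γ) : Prop :=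
  ∃ u z, k = u * g0 * z ∧ |d 1 u - n| ≤ r ∧ |d 1 z - n'| ≤ r ∧
    d 1 u + d 1 g0 + d 1 z ≤ d 1 k + r ∧ e 1 u + e 1 g0 + e 1 z ≤ e 1 k + r

lemma Dat.ins_lower {d e : Γ → Γ → ℝ} (H : Dat d e) (rG R : ℝ) : ∃ r K : ℝ, 0 ≤ r ∧ 0 < K ∧
    ∀ s t, |s| ≤ R → |t| ≤ R → ∀ (g0 : Γ) (n n' : ℝ) (G G' : Finset Γ), (∀ x ∈ G, |d 1 x - n| ≤ rG) →
    (∀ y ∈ G', |d 1 y - n'| ≤ rG) → ∃ I : Finset Γ,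
      (∀ k ∈ I, Ins d e r g0 n n' k ∧ ∃ x ∈ G, ∃ y ∈ G', |d 1 k - d 1 x - d 1 g0 - d 1 y| ≤ r ∧
        |e 1 k - e 1 x - e 1 g0 - e 1 y| ≤ r) ∧
      ww d e s t g0 * ((∑ x ∈ G, ww d e s t x) * (∑ y ∈ G', ww d e s t y)) ≤ K * ∑ k ∈ I, ww d e s t k := by
  classical
  obtain ⟨C, hC0, F, hF, hj⟩ := join H.hd H.he H.ne
  choose f hf h1 h2 using hj
  obtain ⟨M, hM⟩ := mult H.hd (|rG| + 4 * C)
  refine ⟨|rG| + 4 * C, (M * (F.card * F.card) + 1 : ℕ) * Real.exp (2 * R * (2 * C)), by positivity, by positivity, ?_⟩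
  intro s t hs ht g0 n n' G G' hG hG'
  set J : Γ × Γ → Γ := fun p => p.1 * f p.1 (g0 * f g0 p.2 * p.2) * (g0 * f g0 p.2 * p.2) with hJ
  have l := le_abs_self rG
  have l0 := abs_nonneg rG
  have key : ∀ x y, (d 1 x + d 1 g0 + d 1 y ≤ d 1 (J (x, y)) + 2 * C ∧ d 1 (J (x, y)) ≤ d 1 x + d 1 g0 + d 1 y + 2 * C) ∧
      (e 1 x + e 1 g0 + e 1 y ≤ e 1 (J (x, y)) + 2 * C ∧ e 1 (J (x, y)) ≤ e 1 x + e 1 g0 + e 1 y + 2 * C) ∧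
      (|d 1 (x * f x (g0 * f g0 y * y)) - d 1 x| ≤ C ∧ |e 1 (x * f x (g0 * f g0 y * y)) - e 1 x| ≤ C) ∧
      (|d 1 (f g0 y * y) - d 1 y| ≤ C ∧ |e 1 (f g0 y * y) - e 1 y| ≤ C) := by
    intro x y
    set a := g0 * f g0 y * y with ha
    have q1 := h1 x a
    have q2 := h2 x a
    have q3 := h1 g0 y
    have q4 := h2 g0 y
    rw [← ha] at q3 q4
    have f1 := hF _ (hf x a)
    have f2 := hF _ (hf g0 y)
    have e1 : J (x, y) = x * f x a * a := rfl
    rw [e1]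
    have dd : ∀ {m : Γ → Γ → ℝ}, MemD m → m 1 (f x a) ≤ C → m 1 (f g0 y) ≤ C →
        m 1 (x * f x a * a) ≤ m 1 x + m 1 g0 + m 1 y + 2 * C ∧ |m 1 (x * f x a) - m 1 x| ≤ C ∧ |m 1 (f g0 y * y) - m 1 y| ≤ C := by
      intro m hm c1 c2
      have p1 := hm.one_mul_le (x * f x a) a
      have p2 := hm.one_mul_le x (f x a)
      have p3 := hm.one_mul_le (g0 * f g0 y) y
      have p4 := hm.one_mul_le g0 (f g0 y)
      have p5 := hm.one_mul_le (x * f x a) (f x a)⁻¹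
      have p6 := hm.one_mul_le (f g0 y)⁻¹ (f g0 y * y)
      have p7 := hm.one_mul_le (f g0 y) y
      rw [mul_inv_cancel_right, hm.inv] at p5
      rw [inv_mul_cancel_left, hm.inv] at p6
      rw [← ha] at p3
      refine ⟨by linarith, abs_le.2 ⟨by linarith, by linarith⟩, abs_le.2 ⟨by linarith, by linarith⟩⟩
    have D1 := dd H.hd f1.1 f2.1
    have D2 := dd H.he f1.2 f2.2
    exact ⟨⟨by linarith, D1.1⟩, ⟨by linarith, D2.1⟩, ⟨D1.2.1, D2.2.1⟩, ⟨D1.2.2, D2.2.2⟩⟩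
  refine ⟨(G ×ˢ G').image J, ?_, ?_⟩
  · intro k hk
    obtain ⟨⟨x, y⟩, hp, rfl⟩ := Finset.mem_image.1 hk
    rw [Finset.mem_product] at hp
    obtain ⟨⟨a1, a2⟩, ⟨b1, b2⟩, ⟨c1, c2⟩, c3, c4⟩ := key x y
    have g1 := abs_le.1 (hG x hp.1)
    have g2 := abs_le.1 (hG' y hp.2)
    have c1 := abs_le.1 c1
    have c2 := abs_le.1 c2
    have c3 := abs_le.1 c3
    have c4 := abs_le.1 c4
    refine ⟨⟨x * f x (g0 * f g0 y * y), f g0 y * y, ?_, ?_, ?_, ?_, ?_⟩, x, hp.1, y, hp.2, ?_, ?_⟩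
    · simp only [hJ, mul_assoc]
    · rw [abs_le]; constructor <;> linarith
    · rw [abs_le]; constructor <;> linarith
    · linarith
    · linarith
    · rw [abs_le]; constructor <;> linarith
    · rw [abs_le]; constructor <;> linarith
  · rw [Finset.sum_mul_sum, ← Finset.sum_product', Finset.mul_sum]
    refine fibsum (G ×ˢ G') J (fun p => ww d e s t g0 * (ww d e s t p.1 * ww d e s t p.2)) (ww d e s t)
      (Real.exp (2 * R * (2 * C))) (M * (F.card * F.card) + 1) (Real.exp_pos _).le (ww_nn d e s t) ?_ ?_
    · rintro ⟨x, y⟩ hp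
      obtain ⟨⟨a1, a2⟩, ⟨b1, b2⟩, -⟩ := key x y
      unfold ww
      rw [← Real.exp_add, ← Real.exp_add, ← Real.exp_add]
      apply Real.exp_le_exp.2
      have := exp_cmp s t R (2 * C) (e 1 (J (x, y)) - e 1 x - e 1 g0 - e 1 y) (d 1 (J (x, y)) - d 1 x - d 1 g0 - d 1 y) hs ht
        (abs_le.2 ⟨by linarith, by linarith⟩) (abs_le.2 ⟨by linarith, by linarith⟩)
      dsimp only
      linarith
    · intro k Q hQ hQk
      have k1 : (Q.image Prod.fst).card ≤ M := by
        refine hM k n _ ?_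
        intro x hx
        obtain ⟨⟨x', y⟩, hp, rfl⟩ := Finset.mem_image.1 hx
        dsimp only
        have hx' := hG x' (Finset.mem_product.1 (hQ hp)).1
        refine ⟨by linarith, ?_⟩
        obtain ⟨⟨a1, a2⟩, -⟩ := key x' y
        have e0 := hQk _ hp
        rw [e0] at a1
        have e1 : x'⁻¹ * k = f x' (g0 * f g0 y * y) * (g0 * (f g0 y * y)) := by
          rw [← e0]; simp only [hJ]; group
        rw [e1]
        have p1 := H.hd.one_mul_le (f x' (g0 * f g0 y * y)) (g0 * (f g0 y * y))
        have p2 := H.hd.one_mul_le g0 (f g0 y * y)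
        have p3 := H.hd.one_mul_le (f g0 y) y
        have f1 := hF _ (hf x' (g0 * f g0 y * y))
        have f2 := hF _ (hf g0 y)
        linarith
      have k2 : Q.card ≤ ((Q.image Prod.fst) ×ˢ (F ×ˢ F)).card := by
        refine Finset.card_le_card_of_injOn (fun p => (p.1, f p.1 (g0 * f g0 p.2 * p.2), f g0 p.2)) ?_ ?_
        · intro p hp
          exact Finset.mem_coe.2 (Finset.mem_product.2 ⟨Finset.mem_image.2 ⟨p, hp, rfl⟩, Finset.mem_product.2 ⟨hf _ _, hf _ _⟩⟩)
        · intro p hp q hq hpq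
          simp only [Prod.mk.injEq] at hpq
          have q1 := hQk p hp
          have q2 := hQk q hq
          rw [← q2] at q1
          simp only [hJ] at q1
          rw [hpq.2.1, hpq.2.2, hpq.1] at q1
          exact Prod.ext hpq.1 (by simpa using q1)
      rw [Finset.card_product, Finset.card_product] at k2
      exact (k2.trans (Nat.mul_le_mul_right _ k1)).trans (Nat.le_succ _)

lemma Dat.ins_pair {d e : Γ → Γ → ℝ} (H : Dat d e) (r R : ℝ) (hr : 0 ≤ r) : ∃ K : ℝ, 0 < K ∧
    ∀ s, |s| ≤ R → |manhattan d e s| ≤ R → ∀ (g0 : Γ) (n n' m m' : ℝ), n + d 1 g0 ≤ m → ∀ T : Finset Γ,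
    (∀ k ∈ T, Ins d e r g0 n n' k ∧ Ins d e r g0 m m' k) →
    ∑ k ∈ T, ww d e s (manhattan d e s) k ≤ K * ww d e s (manhattan d e s) g0 ^ 2 := by
  classical
  obtain ⟨δ, hδ⟩ := H.hd.hyp
  have hn := hδ.nonneg
  set r2 : ℝ := 3 * (3 * r) + 2 * δ with hr2
  have hr2' : 0 ≤ r2 := by positivity
  obtain ⟨r3, hr3, hst⟩ := star H.hd H.he r2
  set r4 : ℝ := 3 * r + r2 + r3 with hr4
  have hr4' : 0 ≤ r4 := by positivity
  obtain ⟨K, hK, hup⟩ := H.gup r4 R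
  refine ⟨Real.exp (2 * R * r4) * (K * K * K), by positivity, ?_⟩
  intro s hs ht g0 n n' m m' hnm T hT
  set t := manhattan d e s with htt
  have main : ∀ k : Γ, ∃ p : Γ × Γ × Γ, k ∈ T → k = p.1 * g0 * p.2.1 * g0 * p.2.2 ∧ |d 1 p.1 - n| ≤ r4 ∧
      |d 1 p.2.1 - (m - n - d 1 g0)| ≤ r4 ∧ |d 1 p.2.2 - m'| ≤ r4 ∧
      |d 1 p.1 + d 1 g0 + d 1 p.2.1 + d 1 g0 + d 1 p.2.2 - d 1 k| ≤ r4 ∧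
      |e 1 p.1 + e 1 g0 + e 1 p.2.1 + e 1 g0 + e 1 p.2.2 - e 1 k| ≤ r4 := by
    intro k
    by_cases hk : k ∈ T
    swap
    · exact ⟨(1, 1, 1), fun h => absurd h hk⟩
    obtain ⟨⟨u, z, hk1, hu, hz, ha, hb⟩, ⟨u', z', hk1', hu', hz', ha', hb'⟩⟩ := hT k hk
    refine ⟨(u, (u * g0)⁻¹ * u', z'), fun _ => ?_⟩
    dsimp only
    set y := (u * g0)⁻¹ * u' with hy
    have hkk : k = u * g0 * y * g0 * z' := by rw [hy, hk1']; group
    have hu0 := abs_le.1 hu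
    have hu0' := abs_le.1 hu'
    have hz0' := abs_le.1 hz'
    have p1 := H.hd.one_mul_le u g0
    have p2 := H.hd.one_mul_le (u * g0) z
    rw [← hk1] at p2
    have p3 := H.hd.one_mul_le (u' * g0) z'
    have p4 := H.hd.one_mul_le u' g0
    rw [← hk1'] at p3
    have p5 := H.hd.one_mul_le g0 z'
    have q1 : d 1 (u * g0) + d (u * g0) k ≤ d 1 k + 3 * r := by
      rw [H.hd.eq_one (u * g0) k]
      have : (u * g0)⁻¹ * k = z := by rw [hk1]; group
      rw [this]; linarith
    have q2 : d 1 u' + d u' k ≤ d 1 k + 3 * r := by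
      rw [H.hd.eq_one u' k]
      have : u'⁻¹ * k = g0 * z' := by rw [hk1']; group
      rw [this]; linarith
    have q3 := order1 hδ (3 * r) k (u * g0) u' q1 q2 (by linarith)
    rw [abs_of_nonneg (by positivity), ← hr2, H.hd.eq_one (u * g0) u', ← hy] at q3
    have q4 : u * g0 * y = u' := by rw [hy]; group
    have q5 := hst (u * g0) y (by rw [q4]; linarith)
    rw [q4] at q5
    have p6 := H.hd.one_mul_le (u * g0) y
    have p6' := H.he.one_mul_le (u * g0) y
    rw [q4] at p6 p6'
    have t1 := H.he.one_mul_le u g0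
    have t2 := H.he.one_mul_le (u * g0) z
    rw [← hk1] at t2
    have t3 := H.he.one_mul_le (u' * g0) z'
    have t4 := H.he.one_mul_le u' g0
    rw [← hk1'] at t3
    refine ⟨hkk, ?_, ?_, ?_, ?_, ?_⟩ <;> rw [abs_le] <;> constructor <;> linarith
  choose p hp using main
  set P1 := T.image (fun k => (p k).1)
  set P2 := T.image (fun k => (p k).2.1)
  set P3 := T.image (fun k => (p k).2.2)
  have u1 : ∑ g ∈ P1, ww d e s t g ≤ K := hup n s hs ht _ (by
    intro g hg
    obtain ⟨k, hk, rfl⟩ := Finset.mem_image.1 hg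
    exact (hp k hk).2.1)
  have u2 : ∑ g ∈ P2, ww d e s t g ≤ K := hup (m - n - d 1 g0) s hs ht _ (by
    intro g hg
    obtain ⟨k, hk, rfl⟩ := Finset.mem_image.1 hg
    exact (hp k hk).2.2.1)
  have u3 : ∑ g ∈ P3, ww d e s t g ≤ K := hup m' s hs ht _ (by
    intro g hg
    obtain ⟨k, hk, rfl⟩ := Finset.mem_image.1 hg
    exact (hp k hk).2.2.2.1)
  have nn : ∀ P : Finset Γ, 0 ≤ ∑ g ∈ P, ww d e s t g := fun P => Finset.sum_nonneg fun g _ => ww_nn d e s t g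
  set c := Real.exp (2 * R * r4) * ww d e s t g0 ^ 2 with hc
  have hc0 : 0 ≤ c := by positivity
  have s1 : ∑ k ∈ T, ww d e s t k ≤ ∑ k ∈ T, c * (ww d e s t (p k).1 * (ww d e s t (p k).2.1 * ww d e s t (p k).2.2)) := by
    refine Finset.sum_le_sum fun k hk => ?_
    obtain ⟨-, -, -, -, a1, a2⟩ := hp k hk
    have := exp_cmp s t R r4 _ _ hs ht a2 a1
    rw [hc]
    unfold ww
    rw [← Real.exp_nat_mul, ← Real.exp_add, ← Real.exp_add, ← Real.exp_add, ← Real.exp_add]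
    apply Real.exp_le_exp.2
    push_cast
    linarith
  have inj : Set.InjOn p (T : Set Γ) := by
    intro k hk k' hk' h
    rw [(hp k hk).1, (hp k' hk').1, h]
  have s2 : ∑ k ∈ T, c * (ww d e s t (p k).1 * (ww d e s t (p k).2.1 * ww d e s t (p k).2.2)) ≤
      ∑ q ∈ P1 ×ˢ (P2 ×ˢ P3), c * (ww d e s t q.1 * (ww d e s t q.2.1 * ww d e s t q.2.2)) := by
    rw [← Finset.sum_image (f := fun q : Γ × Γ × Γ => c * (ww d e s t q.1 * (ww d e s t q.2.1 * ww d e s t q.2.2))) inj]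
    refine Finset.sum_le_sum_of_subset_of_nonneg ?_ (fun q _ _ => by
      have := ww_nn d e s t q.1
      have := ww_nn d e s t q.2.1
      have := ww_nn d e s t q.2.2
      positivity)
    intro q hq
    obtain ⟨k, hk, rfl⟩ := Finset.mem_image.1 hq
    exact Finset.mem_product.2 ⟨Finset.mem_image.2 ⟨k, hk, rfl⟩, Finset.mem_product.2 ⟨Finset.mem_image.2 ⟨k, hk, rfl⟩, Finset.mem_image.2 ⟨k, hk, rfl⟩⟩⟩
  have s3 : ∑ q ∈ P1 ×ˢ (P2 ×ˢ P3), c * (ww d e s t q.1 * (ww d e s t q.2.1 * ww d e s t q.2.2)) =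
      c * ((∑ g ∈ P1, ww d e s t g) * ((∑ g ∈ P2, ww d e s t g) * ∑ g ∈ P3, ww d e s t g)) := by
    rw [← Finset.mul_sum, Finset.sum_mul_sum P2 P3, ← Finset.sum_product', Finset.sum_mul_sum, ← Finset.sum_product']
  have s4 : (∑ g ∈ P1, ww d e s t g) * ((∑ g ∈ P2, ww d e s t g) * ∑ g ∈ P3, ww d e s t g) ≤ K * (K * K) :=
    mul_le_mul u1 (mul_le_mul u2 u3 (nn _) hK.le) (mul_nonneg (nn _) (nn _)) hK.le
  calc _ ≤ _ := s1
    _ ≤ _ := s2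
    _ = _ := s3
    _ ≤ c * (K * (K * K)) := mul_le_mul_of_nonneg_left s4 hc0
    _ = _ := by rw [hc]; ring

lemma union_bound {ι α : Type*} [DecidableEq α] (w : α → ℝ) (hw : ∀ k, 0 ≤ w k) (S : Finset ι) (E : ι → Finset α) :
    ∑ k ∈ S.biUnion E, w k ≤ ∑ i ∈ S, ∑ k ∈ E i, w k := by
  classical
  induction S using Finset.induction_on with
  | empty => simp
  | insert i S hi ih =>
    rw [Finset.biUnion_insert, Finset.sum_insert hi]
    have e2 := Finset.sum_union_inter (s₁ := E i) (s₂ := S.biUnion E) (f := w)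
    have : 0 ≤ ∑ k ∈ E i ∩ S.biUnion E, w k := Finset.sum_nonneg fun k _ => hw k
    linarith

lemma bonf {α : Type*} [DecidableEq α] (w : α → ℝ) (hw : ∀ k, 0 ≤ w k) (a b : ℝ) (hb0 : 0 ≤ b) (E : ℕ → Finset α) (N : ℕ)
    (h1 : ∀ i < N, a ≤ ∑ k ∈ E i, w k) (h2 : ∀ i j, i < j → j < N → ∑ k ∈ E i ∩ E j, w k ≤ b) :
    ∀ n ≤ N, n * a - n ^ 2 * b ≤ ∑ k ∈ (Finset.range n).biUnion E, w k := by
  intro n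
  induction n with
  | zero => intro _; simp
  | succ n ih =>
    intro hn
    have i1 := ih (by omega)
    set U := (Finset.range n).biUnion E with hU
    have e1 : (Finset.range (n + 1)).biUnion E = U ∪ E n := by
      rw [Finset.range_add_one, Finset.biUnion_insert, Finset.union_comm]
    have e2 := Finset.sum_union_inter (s₁ := U) (s₂ := E n) (f := w)
    have e3 : ∑ k ∈ U ∩ E n, w k ≤ ∑ i ∈ Finset.range n, ∑ k ∈ E i ∩ E n, w k := by
      have : U ∩ E n = (Finset.range n).biUnion (fun i => E i ∩ E n) := by
        rw [hU, Finset.biUnion_inter]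
      rw [this]
      exact union_bound w hw _ _
    have e4 : ∑ i ∈ Finset.range n, ∑ k ∈ E i ∩ E n, w k ≤ ∑ i ∈ Finset.range n, b :=
      Finset.sum_le_sum fun i hi => h2 i n (Finset.mem_range.1 hi) (by omega)
    rw [Finset.sum_const, Finset.card_range, nsmul_eq_mul] at e4
    have hb : 0 ≤ n * b + b := by positivity
    rw [e1]
    have := h1 n (by omega)
    push_cast
    nlinarith

lemma Dat.second {d e : Γ → Γ → ℝ} (H : Dat d e) (s a b C Kg c n0 : ℝ) (hc : 0 < c)
    (hG : ∀ n ≥ n0, ∃ G : Finset Γ, (∀ g ∈ G, |d 1 g - n| ≤ C ∧ |a * e 1 g - b * d 1 g| ≤ Kg) ∧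
      c ≤ ∑ g ∈ G, ww d e s (manhattan d e s) g) :
    ∃ r' c' : ℝ, 0 < c' ∧ ∀ g0 : Γ, ∃ (n : ℝ) (U : Finset Γ), (∀ k ∈ U, |d 1 k - n| ≤ r' ∧
      |(a * e 1 k - b * d 1 k) - (a * e 1 g0 - b * d 1 g0)| ≤ r') ∧
      c' ≤ ∑ g ∈ U, ww d e s (manhattan d e s) g := by
  classical
  set t := manhattan d e s with ht
  set R := |s| + |t| with hR
  have hsR : |s| ≤ R := by have := abs_nonneg t; linarith
  have htR : |t| ≤ R := by have := abs_nonneg s; linarith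
  obtain ⟨r, K, hr, hK, hlow⟩ := H.ins_lower C R
  obtain ⟨K2, hK2, hpair⟩ := H.ins_pair r R hr
  set a0 := c * c / K with ha0
  have ha0' : 0 < a0 := by positivity
  set ρ := a0 / (2 * K2) with hρ
  have hρ0 : 0 < ρ := by positivity
  refine ⟨(r + 2 * C) + (|a| * r + |b| * r + 2 * Kg) + |r + 2 * C| + |Kg| * 2, a0 * ρ / 4, by positivity, fun g0 => ?_⟩
  set w := ww d e s t g0 with hw
  have hw0 : 0 < w := ww_pos d e s t g0
  set q := |n0| + d 1 g0 with hq
  have hA := H.hd.nn 1 g0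
  have hq0 : 0 ≤ q := by positivity
  have hqn : n0 ≤ q := by have := le_abs_self n0; linarith
  have hqA : d 1 g0 ≤ q := by have := abs_nonneg n0; linarith
  have fam : ∀ N : ℕ, ∃ E : ℕ → Finset Γ, ∀ i < N, (∀ k ∈ E i, Ins d e r g0 ((i + 1) * q) ((N - i) * q) k ∧
      |d 1 k - ((N + 1) * q + d 1 g0)| ≤ r + 2 * C ∧
      |(a * e 1 k - b * d 1 k) - (a * e 1 g0 - b * d 1 g0)| ≤ |a| * r + |b| * r + 2 * Kg) ∧
      a0 * w ≤ ∑ k ∈ E i, ww d e s t k := by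
    intro N
    have : ∀ i : ℕ, ∃ I : Finset Γ, i < N → (∀ k ∈ I, Ins d e r g0 ((i + 1) * q) ((N - i) * q) k ∧
      |d 1 k - ((N + 1) * q + d 1 g0)| ≤ r + 2 * C ∧
      |(a * e 1 k - b * d 1 k) - (a * e 1 g0 - b * d 1 g0)| ≤ |a| * r + |b| * r + 2 * Kg) ∧
      a0 * w ≤ ∑ k ∈ I, ww d e s t k := by
      intro i
      by_cases hi : i < N
      swap
      · exact ⟨∅, fun h => absurd h hi⟩
      have hi' : (i:ℝ) + 1 ≤ N := by exact_mod_cast hi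
      have hi0 : (0:ℝ) ≤ i := Nat.cast_nonneg _
      have b1 : q ≤ (i + 1) * q := by nlinarith
      have b2 : q ≤ (N - i) * q := by nlinarith
      obtain ⟨G, hG1, hG2⟩ := hG ((i + 1) * q) (hqn.trans b1)
      obtain ⟨G', hG1', hG2'⟩ := hG ((N - i) * q) (hqn.trans b2)
      obtain ⟨I, hI, hI2⟩ := hlow s t hsR htR g0 ((i + 1) * q) ((N - i) * q) G G' (fun x hx => (hG1 x hx).1) (fun x hx => (hG1' x hx).1)
      refine ⟨I, fun _ => ⟨?_, ?_⟩⟩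
      · intro k hk
        obtain ⟨h1, x, hx, y, hy, h2, h3⟩ := hI k hk
        have x1 := abs_le.1 (hG1 x hx).1
        have y1 := abs_le.1 (hG1' y hy).1
        have x2 := abs_le.1 (hG1 x hx).2
        have y2 := abs_le.1 (hG1' y hy).2
        have m2 : |b * (d 1 k - d 1 x - d 1 g0 - d 1 y)| ≤ |b| * r := by
          rw [abs_mul]; exact mul_le_mul_of_nonneg_left h2 (abs_nonneg _)
        have m3 : |a * (e 1 k - e 1 x - e 1 g0 - e 1 y)| ≤ |a| * r := by
          rw [abs_mul]; exact mul_le_mul_of_nonneg_left h3 (abs_nonneg _)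
        have h2 := abs_le.1 h2
        have m2 := abs_le.1 m2
        have m3 := abs_le.1 m3
        refine ⟨h1, ?_, ?_⟩ <;> rw [abs_le] <;> constructor <;> linarith
      · have h1 : c * c ≤ (∑ x ∈ G, ww d e s t x) * (∑ y ∈ G', ww d e s t y) :=
          mul_le_mul hG2 hG2' hc.le (hc.le.trans hG2)
        have h2 := (mul_le_mul_of_nonneg_left h1 hw0.le).trans hI2
        have h3 : a0 * w = (w * (c * c)) / K := by rw [ha0]; ring
        rw [h3, div_le_iff₀ hK]; linarith
    choose E hE using this
    exact ⟨E, hE⟩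
  have fin : ∀ N : ℕ, 0 < N → ∀ bb : ℝ, 0 ≤ bb → (N = 1 ∨ K2 * w ^ 2 ≤ bb) → a0 * ρ / 4 ≤ N * (a0 * w) - N ^ 2 * bb →
      ∃ (n : ℝ) (U : Finset Γ), (∀ k ∈ U, |d 1 k - n| ≤ (r + 2 * C) + (|a| * r + |b| * r + 2 * Kg) + |r + 2 * C| + |Kg| * 2 ∧
      |(a * e 1 k - b * d 1 k) - (a * e 1 g0 - b * d 1 g0)| ≤ (r + 2 * C) + (|a| * r + |b| * r + 2 * Kg) + |r + 2 * C| + |Kg| * 2) ∧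
      a0 * ρ / 4 ≤ ∑ g ∈ U, ww d e s t g := by
    intro N hN bb hbb hcase hle
    obtain ⟨E, hE⟩ := fam N
    refine ⟨(N + 1) * q + d 1 g0, (Finset.range N).biUnion E, ?_, ?_⟩
    · intro k hk
      obtain ⟨i, hi, hk⟩ := Finset.mem_biUnion.1 hk
      obtain ⟨-, h1, h2⟩ := (hE i (Finset.mem_range.1 hi)).1 k hk
      have l1 := neg_abs_le (r + 2 * C)
      have l2 := neg_abs_le Kg
      have : 0 ≤ |a| * r := by positivity
      have : 0 ≤ |b| * r := by positivity
      constructor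
      · have := abs_nonneg (r + 2 * C)
        linarith
      · have := abs_nonneg Kg
        linarith
    · refine hle.trans ?_
      refine bonf (ww d e s t) (ww_nn d e s t) (a0 * w) bb hbb E N (fun i hi => (hE i hi).2) ?_ N le_rfl
      intro i j hij hj
      rcases hcase with h | h
      · omega
      · refine le_trans ?_ h
        refine hpair s hsR htR g0 ((i + 1) * q) ((N - i) * q) ((j + 1) * q) ((N - j) * q) ?_ _ ?_
        · have : (i:ℝ) + 1 ≤ j := by exact_mod_cast hij
          nlinarith
        · intro k hk
          rw [Finset.mem_inter] at hk
          exact ⟨((hE i (hij.trans hj)).1 k hk.1).1, ((hE j hj).1 k hk.2).1⟩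
  rcases le_or_gt ρ w with hcase | hcase
  · refine fin 1 one_pos 0 le_rfl (Or.inl rfl) ?_
    have := mul_le_mul_of_nonneg_left hcase ha0'.le
    have : 0 < a0 * ρ := by positivity
    simp
    linarith
  · have h1 : 1 ≤ ρ / w := by rw [le_div_iff₀ hw0]; linarith
    have hN1 : 1 ≤ ⌊ρ / w⌋₊ := (Nat.one_le_floor_iff _).2 h1
    set N := ⌊ρ / w⌋₊ with hN
    have hle : (N:ℝ) ≤ ρ / w := Nat.floor_le (by positivity)
    have hlt : ρ / w < N + 1 := Nat.lt_floor_add_one _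
    rw [le_div_iff₀ hw0] at hle
    rw [div_lt_iff₀ hw0] at hlt
    have hN1' : (1:ℝ) ≤ N := by exact_mod_cast hN1
    have hge : ρ / 2 ≤ N * w := by nlinarith
    refine fin N hN1 (K2 * w ^ 2) (by positivity) (Or.inr le_rfl) ?_
    have e1 : (N:ℝ) * (a0 * w) - N ^ 2 * (K2 * w ^ 2) = (N * w) * (a0 - K2 * (N * w)) := by ring
    rw [e1]
    have e2 : K2 * (N * w) ≤ a0 / 2 := by
      have := mul_le_mul_of_nonneg_left hle hK2.le
      have e3 : K2 * ρ = a0 / 2 := by rw [hρ]; field_simp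
      linarith
    have := mul_le_mul hge (show a0 / 2 ≤ a0 - K2 * (N * w) by linarith) (by positivity) (by positivity)
    linarith

lemma Dat.good {d e : Γ → Γ → ℝ} (H : Dat d e) (hh : manhattan d e (manhattan e d 0 / 2) = manhattan d e 0 / 2) :
    ∃ C Kg c : ℝ, 0 < c ∧ ∀ n ≥ 2 * C, ∃ G : Finset Γ,
      (∀ g ∈ G, |d 1 g - n| ≤ C ∧ |manhattan e d 0 * e 1 g - manhattan d e 0 * d 1 g| ≤ Kg) ∧
      c ≤ ∑ g ∈ G, ww d e 0 (manhattan d e 0) g ∧ c ≤ ∑ g ∈ G, ww d e (manhattan e d 0) 0 g := by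
  classical
  have hz := H.zero
  have hv := H.v_pos
  have hvs := H.vs.2
  set v := manhattan d e 0 with hvv
  set u := manhattan e d 0 with huu
  obtain ⟨C, hC0, hlo⟩ := H.glo
  obtain ⟨c, hc, hlo⟩ := hlo (v + u)
  obtain ⟨K, hK, hup⟩ := H.gup C (v + u)
  obtain ⟨Λ, c1, hΛ, hc1, hmid⟩ := middle (Γ := Γ) c K hc hK
  refine ⟨C, 2 * Λ, c1 * Real.exp (-(2 * Λ)), by positivity, fun n hn => ?_⟩
  have e1 : ∀ g, ww d e 0 v g * Real.exp (2 * (-(u * e 1 g - v * d 1 g) / 2)) = ww d e u 0 g := by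
    intro g; unfold ww; rw [← Real.exp_add]; congr 1; ring
  have e2 : ∀ g, ww d e 0 v g * Real.exp (-(u * e 1 g - v * d 1 g) / 2) = ww d e (u / 2) (v / 2) g := by
    intro g; unfold ww; rw [← Real.exp_add]; congr 1; ring
  have hm := hmid (sh d n C) (ww d e 0 v) (fun g => -(u * e 1 g - v * d 1 g) / 2) (ww_nn d e 0 v) ?_ ?_ ?_
  · set G := {g ∈ sh d n C | |-(u * e 1 g - v * d 1 g) / 2| ≤ Λ} with hG
    have hGm : ∀ g ∈ G, |d 1 g - n| ≤ C ∧ |u * e 1 g - v * d 1 g| ≤ 2 * Λ := by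
      intro g hg
      rw [hG, Finset.mem_filter, H.hd.mem_sh] at hg
      have h2 := abs_le.1 hg.2
      refine ⟨hg.1, abs_le.2 ⟨by linarith, by linarith⟩⟩
    refine ⟨G, hGm, le_trans ?_ hm, ?_⟩
    · have : Real.exp (-(2 * Λ)) ≤ 1 := Real.exp_le_one_iff.2 (by linarith)
      have := mul_le_mul_of_nonneg_left this hc1.le
      linarith
    · refine (mul_le_mul_of_nonneg_right hm (Real.exp_pos _).le).trans ?_
      rw [Finset.sum_mul]
      refine Finset.sum_le_sum fun g hg => ?_
      have := abs_le.1 (hGm g hg).2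
      unfold ww
      rw [← Real.exp_add]
      apply Real.exp_le_exp.2
      linarith
  · exact hup n 0 (by rw [abs_zero]; linarith) (by rw [abs_of_pos hv]; linarith) _ (fun g hg => H.hd.mem_sh.1 hg)
  · simp only [e1]
    have := hup n u (by rw [abs_of_pos hvs]; linarith) (by rw [hz, abs_zero]; linarith) _ (fun g hg => H.hd.mem_sh.1 hg)
    rwa [hz] at this
  · simp only [e2]
    exact hlo n (u / 2) (v / 2) (by rw [abs_of_pos (by linarith)]; linarith) (by rw [abs_of_pos (by linarith)]; linarith) hh.ge hn

lemma Dat.bounded {d e : Γ → Γ → ℝ} (H : Dat d e) (hh : manhattan d e (manhattan e d 0 / 2) = manhattan d e 0 / 2) :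
    ∃ B : ℝ, ∀ g, |manhattan e d 0 * e 1 g - manhattan d e 0 * d 1 g| ≤ B := by
  obtain ⟨C, Kg, c, hc, hG⟩ := H.good hh
  have hz := H.zero
  have hv := H.v_pos
  have hvs := H.vs.2
  set v := manhattan d e 0 with hvv
  set u := manhattan e d 0 with huu
  obtain ⟨r0, c0, hc0, h0⟩ := H.second 0 u v C Kg c (2 * C) hc (fun n hn => by
    obtain ⟨G, h1, h2, h3⟩ := hG n hn
    exact ⟨G, h1, h2⟩)
  obtain ⟨r1, c1, hc1, h1⟩ := H.second u u v C Kg c (2 * C) hc (fun n hn => by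
    obtain ⟨G, h1, h2, h3⟩ := hG n hn
    refine ⟨G, h1, ?_⟩
    rw [hz]; exact h3)
  rw [hz] at h1
  rw [← hvv] at h0
  obtain ⟨K0, hK0, hup0⟩ := H.gup r1 (v + u)
  obtain ⟨K1, hK1, hup1⟩ := H.gup r0 (v + u)
  refine ⟨|Real.log (K0 / c1) + r1| + |Real.log (K1 / c0) + r0|, fun g0 => ?_⟩
  set D := u * e 1 g0 - v * d 1 g0 with hD
  have up : D ≤ Real.log (K0 / c1) + r1 := by
    obtain ⟨n, U, hU, hs⟩ := h1 g0
    have k1 := hup0 n 0 (by rw [abs_zero]; linarith) (by rw [abs_of_pos hv]; linarith) U (fun g hg => (hU g hg).1)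
    have k2 : c1 * Real.exp (D - r1) ≤ K0 := by
      refine (mul_le_mul_of_nonneg_right hs (Real.exp_pos _).le).trans (le_trans ?_ k1)
      rw [Finset.sum_mul]
      refine Finset.sum_le_sum fun g hg => ?_
      have := abs_le.1 (hU g hg).2
      unfold ww
      rw [← Real.exp_add]
      apply Real.exp_le_exp.2
      linarith
    have k3 : Real.exp (D - r1) ≤ K0 / c1 := by rw [le_div_iff₀ hc1]; linarith
    have := (Real.le_log_iff_exp_le (by positivity)).2 k3
    linarith
  have lo : -D ≤ Real.log (K1 / c0) + r0 := by
    obtain ⟨n, U, hU, hs⟩ := h0 g0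
    have k1 := hup1 n u (by rw [abs_of_pos hvs]; linarith) (by rw [hz, abs_zero]; linarith) U (fun g hg => (hU g hg).1)
    rw [hz] at k1
    have k2 : c0 * Real.exp (-D - r0) ≤ K1 := by
      refine (mul_le_mul_of_nonneg_right hs (Real.exp_pos _).le).trans (le_trans ?_ k1)
      rw [Finset.sum_mul]
      refine Finset.sum_le_sum fun g hg => ?_
      have := abs_le.1 (hU g hg).2
      unfold ww
      rw [← Real.exp_add]
      apply Real.exp_le_exp.2
      linarith
    have k3 : Real.exp (-D - r0) ≤ K1 / c0 := by rw [le_div_iff₀ hc0]; linarith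
    have := (Real.le_log_iff_exp_le (by positivity)).2 k3
    linarith
  have a1 := le_abs_self (Real.log (K0 / c1) + r1)
  have a2 := le_abs_self (Real.log (K1 / c0) + r0)
  have a3 := abs_nonneg (Real.log (K0 / c1) + r1)
  have a4 := abs_nonneg (Real.log (K1 / c0) + r0)
  rw [abs_le]; constructor <;> linarith

lemma rs_of_bound {d e : Γ → Γ → ℝ} (hd : MemD d) (he : MemD e) (Λ C : ℝ) (hΛ : 0 < Λ)
    (h : ∀ g, |d 1 g - Λ * e 1 g| ≤ C) : RoughlySimilar d e := by
  refine ⟨Λ, hΛ, |C| + 1, by positivity, fun g k => ?_⟩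
  rw [hd.eq_one, he.eq_one]
  have := h (g⁻¹ * k)
  have := le_abs_self C
  linarith

lemma Dat.rs_of_tau {d e : Γ → Γ → ℝ} (H : Dat d e)
    (h : - deriv (manhattan d e) 0 = growthRate d / growthRate e) : RoughlySimilar d e := by
  rw [H.growth, H.vs.1] at h
  have hz := H.zero
  have hv := H.v_pos
  have hvs := H.vs.2
  have ht := H.tangent (manhattan e d 0 / 2)
  have hcv := H.convex.2 (mem_univ 0) (mem_univ (manhattan e d 0)) (show (0:ℝ) ≤ 1 / 2 by norm_num)
    (show (0:ℝ) ≤ 1 / 2 by norm_num) (by norm_num)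
  rw [smul_eq_mul, smul_eq_mul, smul_eq_mul, smul_eq_mul, hz] at hcv
  have e0 : (1 / 2 : ℝ) * 0 + 1 / 2 * manhattan e d 0 = manhattan e d 0 / 2 := by ring
  rw [e0] at hcv
  have e1 : deriv (manhattan d e) 0 * (manhattan e d 0 / 2) = - (manhattan d e 0 / 2) := by
    have : deriv (manhattan d e) 0 = - (manhattan d e 0 / manhattan e d 0) := by linarith
    rw [this]; field_simp
  obtain ⟨B, hB⟩ := H.bounded (le_antisymm (by linarith) (by linarith))
  refine rs_of_bound H.hd H.he (manhattan e d 0 / manhattan d e 0) (B / manhattan d e 0) (by positivity) fun g => ?_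
  have e2 : d 1 g - manhattan e d 0 / manhattan d e 0 * e 1 g =
    - (manhattan e d 0 * e 1 g - manhattan d e 0 * d 1 g) / manhattan d e 0 := by field_simp; ring
  rw [e2, abs_div, abs_neg, abs_of_pos hv]
  exact div_le_div_of_nonneg_right (hB g) hv.le

lemma Dat.line_of_rs {d e : Γ → Γ → ℝ} (H : Dat d e) (h : RoughlySimilar d e) :
    ∃ a b : ℝ, ∀ s : ℝ, manhattan d e s = a * s + b := by
  obtain ⟨Λ, hΛ, C, hC, h⟩ := h
  have key : ∀ s t s' t', s / Λ + t = s' / Λ + t' → Summable (ww d e s t) → Summable (ww d e s' t') := by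
    intro s t s' t' he hs
    refine Summable.of_nonneg_of_le (ww_nn d e s' t') (fun g => ?_) (hs.mul_left (Real.exp (|(s - s') / Λ| * C)))
    unfold ww
    rw [← Real.exp_add]
    apply Real.exp_le_exp.2
    have h1 : |(s - s') / Λ * (d 1 g - Λ * e 1 g)| ≤ |(s - s') / Λ| * C := by
      rw [abs_mul]; exact mul_le_mul_of_nonneg_left (h 1 g) (abs_nonneg _)
    have h2 := abs_le.1 h1
    have e1 : (s - s') / Λ * (d 1 g - Λ * e 1 g) = (s / Λ - s' / Λ) * d 1 g - (s - s') * e 1 g := by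
      field_simp
    have e2 : (s / Λ - s' / Λ) * d 1 g = (t' - t) * d 1 g := by congr 1; linarith
    rw [e1, e2] at h2
    linarith
  refine ⟨-(1 / Λ), manhattan d e 0, fun s => le_antisymm ?_ ?_⟩
  · refine le_of_forall_pos_le_add fun ε hε => ?_
    have := key 0 (manhattan d e 0 + ε) s (-(1 / Λ) * s + manhattan d e 0 + ε) (by ring)
      (H.summable_of_lt (by linarith))
    exact H.le_of_summable this
  · refine le_of_forall_pos_le_add fun ε hε => ?_
    have := key s (manhattan d e s + ε) 0 (manhattan d e s + ε + s / Λ) (by ring)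
      (H.summable_of_lt (by linarith))
    have := H.le_of_summable this
    have e1 : -(1 / Λ) * s = - (s / Λ) := by ring
    rw [e1]; linarith

lemma Dat.tau_of_line {d e : Γ → Γ → ℝ} (H : Dat d e) (h : ∃ a b : ℝ, ∀ s : ℝ, manhattan d e s = a * s + b) :
    - deriv (manhattan d e) 0 = growthRate d / growthRate e := by
  obtain ⟨a, b, h⟩ := h
  rw [H.growth, H.vs.1]
  have hz := H.zero
  have hvs := H.vs.2
  have hd : deriv (manhattan d e) 0 = a := by
    have : manhattan d e = fun s => a * s + b := funext h
    rw [this]; simp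
  rw [h] at hz
  have h0 := h 0
  rw [hd, h0, eq_div_iff hvs.ne']
  linarith

lemma MemD.tl {d : Γ → Γ → ℝ} (hd : MemD d) (g : Γ) :
    Tendsto (fun n : ℕ => d 1 (g ^ n) / n) atTop (nhds (translationLength d g)) := by
  have hs : Subadditive (fun n : ℕ => d 1 (g ^ n)) := by
    intro m n
    simp only [pow_add]
    exact hd.one_mul_le _ _
  have hb : BddBelow (range fun n : ℕ => d 1 (g ^ n) / n) := by
    refine ⟨0, ?_⟩
    rintro x ⟨n, rfl⟩
    exact div_nonneg (hd.nn _ _) (Nat.cast_nonneg _)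
  exact tendsto_nhds_limUnder ⟨_, hs.tendsto_lim hb⟩

lemma Dat.tl_of_rs {d e : Γ → Γ → ℝ} (H : Dat d e) (h : RoughlySimilar d e) :
    ∃ c > (0:ℝ), ∀ g : Γ, translationLength d g = c * translationLength e g := by
  obtain ⟨Λ, hΛ, C, hC, h⟩ := h
  refine ⟨Λ, hΛ, fun g => ?_⟩
  have h1 := (H.hd.tl g).sub ((H.he.tl g).const_mul Λ)
  have h2 : Tendsto (fun n : ℕ => d 1 (g ^ n) / n - Λ * (e 1 (g ^ n) / n)) atTop (nhds 0) := by
    refine squeeze_zero_norm (a := fun n : ℕ => C / n) (fun n => ?_) (tendsto_const_div_atTop_nhds_zero_nat C)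
    have e1 : d 1 (g ^ n) / n - Λ * (e 1 (g ^ n) / n) = (d 1 (g ^ n) - Λ * e 1 (g ^ n)) / n := by ring
    rw [Real.norm_eq_abs, e1, abs_div, Nat.abs_cast]
    exact div_le_div_of_nonneg_right (h 1 _) (Nat.cast_nonneg _)
  have := tendsto_nhds_unique h1 h2
  linarith

lemma MemD.tl_le {d : Γ → Γ → ℝ} (hd : MemD d) (g : Γ) : translationLength d g ≤ d 1 g := by
  refine le_of_tendsto' (hd.tl g) fun n => ?_
  have : d 1 (g ^ n) ≤ n * d 1 g := by
    induction n with
    | zero => simp [hd.isMetric.refl]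
    | succ n ih =>
      have := hd.one_mul_le (g ^ n) g
      rw [pow_succ]; push_cast; linarith
  rcases Nat.eq_zero_or_pos n with rfl | hn
  · simpa using hd.nn 1 g
  · have : (0:ℝ) < n := by exact_mod_cast hn
    rw [div_le_iff₀ this]; linarith

lemma MemD.tl_ge {d : Γ → Γ → ℝ} {δ : ℝ} (hd : MemD d) (hδ : Hyp d δ) (u : Γ) :
    d 1 (u * u) - d 1 u - 2 * δ ≤ translationLength d u := by
  set η := d 1 (u * u) - d 1 u - 2 * δ with hη
  rcases le_or_gt η 0 with h | h
  · refine h.trans (ge_of_tendsto' (hd.tl u) fun n => ?_)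
    exact div_nonneg (hd.nn _ _) (Nat.cast_nonneg _)
  · have hn := hδ.nonneg
    have step : ∀ n : ℕ, d 1 (u ^ n) + η ≤ d 1 (u ^ (n + 1)) := by
      intro n
      induction n with
      | zero =>
        have := hd.one_mul_le u u
        simp only [pow_zero, zero_add, pow_one, hd.isMetric.refl]
        linarith
      | succ n ih =>
        have e1 : d u (u ^ (n + 2)) = d 1 (u ^ (n + 1)) := by
          rw [hd.eq_one]; congr 1; rw [pow_succ' u (n + 1)]; group
        have e2 : d (u * u) (u ^ (n + 2)) = d 1 (u ^ n) := by
          rw [hd.eq_one]; congr 1; rw [pow_succ' u (n + 1), pow_succ' u n]; group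
        have e3 : d (u * u) u = d 1 u := by
          rw [hd.isMetric.symm, hd.eq_one]; congr 1; group
        have fp := hδ.fp 1 (u * u) u (u ^ (n + 2))
        rw [e1, e2, e3] at fp
        rcases fp with q | q
        · linarith
        · linarith
    have hlow : ∀ n : ℕ, n * η ≤ d 1 (u ^ n) := by
      intro n
      induction n with
      | zero => simp [hd.isMetric.refl]
      | succ n ih => have := step n; push_cast; linarith
    refine ge_of_tendsto (hd.tl u) ?_
    filter_upwards [eventually_gt_atTop 0] with n hn
    have : (0:ℝ) < n := by exact_mod_cast hn
    rw [le_div_iff₀ this]; linarith [hlow n]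

lemma Dat.rs_of_tl {d e : Γ → Γ → ℝ} (H : Dat d e)
    (h : ∃ c > (0:ℝ), ∀ g : Γ, translationLength d g = c * translationLength e g) : RoughlySimilar d e := by
  obtain ⟨c, hc, h⟩ := h
  obtain ⟨C, hC0, F, hF, hj⟩ := join H.hd H.he H.ne
  obtain ⟨δ, hδ⟩ := H.hd.hyp
  obtain ⟨δ', hδ'⟩ := H.he.hyp
  have hn := hδ.nonneg
  have hn' := hδ'.nonneg
  refine rs_of_bound H.hd H.he c ((3 * C + 2 * δ) + c * (3 * C + 2 * δ')) hc fun g => ?_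
  obtain ⟨f, hf, h1, h2⟩ := hj g g
  have aux : ∀ {m : Γ → Γ → ℝ} {η : ℝ}, MemD m → Hyp m η → m 1 f ≤ C → m 1 g + m 1 g ≤ m 1 (g * f * g) + C →
      |translationLength m (g * f) - m 1 g| ≤ 3 * C + 2 * η := by
    intro m η hm hη h3 h4
    have p1 := hm.tl_le (g * f)
    have p2 := hm.tl_ge hη (g * f)
    have p3 := hm.one_mul_le g f
    have p4 := hm.one_mul_le (g * f * (g * f)) f⁻¹
    have e1 : g * f * (g * f) * f⁻¹ = g * f * g := by group
    rw [e1, hm.inv] at p4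
    have := hη.nonneg
    rw [abs_le]; constructor <;> linarith
  have a1 := abs_le.1 (aux H.hd hδ (hF f hf).1 h1)
  have a2 := aux H.he hδ' (hF f hf).2 h2
  rw [h] at a1
  have a3 : |c * (translationLength e (g * f) - e 1 g)| ≤ c * (3 * C + 2 * δ') := by
    rw [abs_mul, abs_of_pos hc]; exact mul_le_mul_of_nonneg_left a2 hc.le
  have a3 := abs_le.1 a3
  rw [abs_le]; constructor <;> linarith

/-- **Theorem 2.7 (Cantrell–Tanaka).** Existence of the mean distortion and the
rigidity characterisations of rough similarity. -/
theorem mean_distortion_and_rigidity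
    (hΓ : IsHyperbolicGroup Γ) (hNE : NonElementary Γ)
    (d dst : Γ → Γ → ℝ) (hd : MemD d) (hdst : MemD dst) :
    ∃ τ : ℝ, 0 < τ ∧ IsMeanDistortion d dst τ ∧
      τ = - deriv (manhattan d dst) 0 ∧
      growthRate d / growthRate dst ≤ τ ∧
      (RoughlySimilar d dst ↔ ∃ a b : ℝ, ∀ s : ℝ, manhattan d dst s = a * s + b) ∧
      (RoughlySimilar d dst ↔ τ = growthRate d / growthRate dst) ∧
      (RoughlySimilar d dst ↔ ∃ c > (0:ℝ), ∀ g : Γ,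
        translationLength d g = c * translationLength dst g) := by
  have H : Dat d dst := ⟨hd, hdst, hNE⟩
  have A : RoughlySimilar d dst → ∃ a b : ℝ, ∀ s : ℝ, manhattan d dst s = a * s + b := H.line_of_rs
  exact ⟨- deriv (manhattan d dst) 0, H.tau_pos, H.mean, rfl, H.tau_ge,
    ⟨A, fun h => H.rs_of_tau (H.tau_of_line h)⟩,
    ⟨fun h => H.tau_of_line (A h), H.rs_of_tau⟩,
    ⟨H.tl_of_rs, H.rs_of_tl⟩⟩

end PaperCLT
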